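/- arXiv:2205.00596 — 3 statements merged into one kernel-verified Lean document; each statement's English description precedes it below -/
import Mathlib

section
/- Let w ∈ W be a non-identity element and let w = τ_{k_1}^{i_{k_1}}·τ_{k_2}^{i_{k_2}}⋯τ_{k_m}^{i_{k_m}} be its generalized standard OGS presentation, i.e. 1 ≤ k_1 < k_2 < ⋯ < k_m ≤ n and the i_{k_j} are nonzero integers with −k_j ≤ i_{k_j} ≤ k_j − 1. Then w belongs to Ṡ_n if and only if both of the following hold: (a) Σ_{j=1}^m i_{k_j} = 0, and (b) 0 ≤ Σ_{j=r}^m i_{k_j} ≤ k_{r−1} for every 2 ≤ r ≤ m. Moreover, when these conditions hold, i_{k_1} < 0. -/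
/-- The Coxeter matrix of type `Bₙ`, with the bond of order `4` between the
generators of indices `0` and `1` (the paper's convention): `s_i² = 1`,
`(s_0·s_1)⁴ = 1`, `(s_i·s_{i+1})³ = 1` for `1 ≤ i ≤ n-2`, and `(s_i·s_j)² = 1`
for `|i-j| ≥ 2`. -/
def BCoxeterMatrix (n : ℕ) : CoxeterMatrix (Fin n) where
  M := Matrix.of fun i j : Fin n ↦
    if i = j then 1
      else if ((i : ℕ) = 0 ∧ (j : ℕ) = 1) ∨ ((j : ℕ) = 0 ∧ (i : ℕ) = 1) then 4
      else if (j : ℕ) + 1 = i ∨ (i : ℕ) + 1 = j then 3 else 2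
  isSymm := by unfold Matrix.IsSymm; aesop
  diagonal := by simp
  off_diagonal := by aesop

variable {n : ℕ} {W : Type*} [Group W]

/-- The simple reflection `s_j` of the Coxeter system, for `0 ≤ j ≤ n-1`
(junk value `1` for `j ≥ n`). -/
def sgen (cs : CoxeterSystem (BCoxeterMatrix n) W) (j : ℕ) : W :=
  if h : j < n then cs.simple ⟨j, h⟩ else 1

/-- `tau cs k` is the element `τ_k = s_0 · s_1 ⋯ s_{k-1}` (with `τ_0 = 1`). -/
def tau (cs : CoxeterSystem (BCoxeterMatrix n) W) (k : ℕ) : W :=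
  ((List.range k).map (sgen cs)).prod

/-- The parabolic subgroup `Ṡ_n` of `W` generated by `s_1, …, s_{n-1}`. -/
def Sdot (cs : CoxeterSystem (BCoxeterMatrix n) W) : Subgroup W :=
  Subgroup.closure (cs.simple '' {j : Fin n | (j : ℕ) ≠ 0})

theorem tau_succ (cs : CoxeterSystem (BCoxeterMatrix n) W) (k : ℕ) :
    tau cs (k + 1) = tau cs k * sgen cs k := by
  simp [tau, List.range_succ]

theorem tau_zero (cs : CoxeterSystem (BCoxeterMatrix n) W) : tau cs 0 = 1 := by
  simp [tau]

theorem sgen_mul_self (cs : CoxeterSystem (BCoxeterMatrix n) W) (j : ℕ) :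
    sgen cs j * sgen cs j = 1 := by
  unfold sgen
  split_ifs <;> simp

theorem sgen_inv (cs : CoxeterSystem (BCoxeterMatrix n) W) (j : ℕ) :
    (sgen cs j)⁻¹ = sgen cs j :=
  inv_eq_of_mul_eq_one_left (sgen_mul_self cs j)

theorem sgen_mem_Sdot (cs : CoxeterSystem (BCoxeterMatrix n) W) {j : ℕ} (hj : j ≠ 0) :
    sgen cs j ∈ Sdot cs := by
  unfold sgen
  split_ifs with h
  · exact Subgroup.subset_closure ⟨⟨j, h⟩, hj, rfl⟩
  · exact one_mem _

theorem sgen_commute (cs : CoxeterSystem (BCoxeterMatrix n) W) {i j : ℕ} (hij : i + 2 ≤ j) :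
    Commute (sgen cs i) (sgen cs j) := by
  by_cases hj : j < n
  · have hi : i < n := by omega
    have h := cs.simple_mul_simple_pow ⟨i, hi⟩ ⟨j, hj⟩
    have hM : BCoxeterMatrix n ⟨i, hi⟩ ⟨j, hj⟩ = 2 := by
      simp only [BCoxeterMatrix, Matrix.of_apply, Fin.mk.injEq]
      grind
    rw [hM, pow_two] at h
    have h' := eq_inv_of_mul_eq_one_left h
    rw [mul_inv_rev, cs.inv_simple, cs.inv_simple] at h'
    simpa [Commute, SemiconjBy, sgen, hi, hj] using h'
  · simp [sgen, hj]

theorem sgen_braid (cs : CoxeterSystem (BCoxeterMatrix n) W) {j : ℕ} (hj : j ≠ 0)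
    (hjn : j + 1 < n) :
    sgen cs j * sgen cs (j + 1) * sgen cs j =
      sgen cs (j + 1) * sgen cs j * sgen cs (j + 1) := by
  have hi : j < n := by omega
  have h := cs.simple_mul_simple_pow ⟨j, hi⟩ ⟨j + 1, hjn⟩
  have hM : BCoxeterMatrix n ⟨j, hi⟩ ⟨j + 1, hjn⟩ = 3 := by
    simp only [BCoxeterMatrix, Matrix.of_apply, Fin.mk.injEq]
    grind
  rw [hM, pow_three, ← mul_assoc] at h
  have h' := eq_inv_of_mul_eq_one_left h
  simp only [sgen, hi, hjn, dif_pos]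
  calc _ = (cs.simple ⟨j, hi⟩ * cs.simple ⟨j + 1, hjn⟩ *
        (cs.simple ⟨j, hi⟩ * cs.simple ⟨j + 1, hjn⟩)) * cs.simple ⟨j + 1, hjn⟩ := by
        simp [mul_assoc]
    _ = _ := by rw [h']; simp [mul_assoc]

theorem tau_commute_sgen (cs : CoxeterSystem (BCoxeterMatrix n) W) {k j : ℕ} (h : k + 1 ≤ j) :
    Commute (tau cs k) (sgen cs j) := by
  induction k with
  | zero => simp [tau_zero]
  | succ k ih =>
    rw [tau_succ]
    exact (ih (by omega)).mul_left (sgen_commute cs (by omega))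

/-- Conjugation by `τ_k` shifts the indices of the simple reflections `s_1, …, s_{k-2}`. -/
theorem sgen_succ_mul_tau (cs : CoxeterSystem (BCoxeterMatrix n) W) {k j : ℕ} (hj : j ≠ 0)
    (hjk : j + 2 ≤ k) (hk : k ≤ n) :
    sgen cs (j + 1) * tau cs k = tau cs k * sgen cs j := by
  induction k, hjk using Nat.le_induction with
  | base =>
    rw [tau_succ, tau_succ, ← mul_assoc, ← mul_assoc,
      ← (tau_commute_sgen cs (le_refl (j + 1))).eq]
    simp only [mul_assoc]
    rw [← mul_assoc (sgen cs (j + 1)), ← sgen_braid cs hj (by omega), mul_assoc]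
  | succ k hk' ih =>
    rw [tau_succ, ← mul_assoc, ih (by omega), mul_assoc, mul_assoc,
      (sgen_commute cs hk').eq]

theorem conj_sgen_tau_pow_eq (cs : CoxeterSystem (BCoxeterMatrix n) W) {k j : ℕ}
    (hk : k + 1 ≤ n) (hj : j + 2 ≤ k) :
    (tau cs k)⁻¹ ^ (j + 1) * sgen cs k * tau cs k ^ (j + 1) =
      sgen cs (k - j - 1) * ((tau cs k)⁻¹ ^ j * sgen cs k * tau cs k ^ j) *
        sgen cs (k - j - 1) := by
  induction j with
  | zero =>
    obtain ⟨l, rfl⟩ : ∃ l, k = l + 1 := ⟨k - 1, by omega⟩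
    have h := (tau_commute_sgen cs (le_refl (l + 1))).inv_left.eq
    simp [tau_succ, mul_assoc, sgen_inv]
    rw [← mul_assoc (tau cs l)⁻¹, h]
    simp [mul_assoc]
  | succ j ih =>
    have hs : (tau cs k)⁻¹ * sgen cs (k - j - 1) * tau cs k = sgen cs (k - (j + 1) - 1) := by
      have := sgen_succ_mul_tau cs (k := k) (j := k - (j + 1) - 1) (by omega) (by omega)
        (by omega)
      rw [show k - (j + 1) - 1 + 1 = k - j - 1 by omega] at this
      rw [mul_assoc, this, inv_mul_cancel_left]
    have hconj (x : W) (l : ℕ) : (tau cs k)⁻¹ ^ (l + 1) * x * tau cs k ^ (l + 1) =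
        (tau cs k)⁻¹ * ((tau cs k)⁻¹ ^ l * x * tau cs k ^ l) * tau cs k := by
      rw [pow_succ' _ l, pow_succ _ l]
      simp only [mul_assoc]
    rw [hconj _ (j + 1), ← hs]
    nth_rw 1 [ih (by omega)]
    rw [hconj _ j]
    group

theorem conj_sgen_tau_pow_mem_Sdot (cs : CoxeterSystem (BCoxeterMatrix n) W) {k j : ℕ}
    (hk : k + 1 ≤ n) (hj : j + 1 ≤ k) :
    (tau cs k)⁻¹ ^ j * sgen cs k * tau cs k ^ j ∈ Sdot cs := by
  induction j with
  | zero => simpa using sgen_mem_Sdot cs (by omega)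
  | succ j ih =>
    rw [conj_sgen_tau_pow_eq cs hk (by omega)]
    have h := sgen_mem_Sdot cs (j := k - j - 1) (by omega)
    exact mul_mem (mul_mem h (ih (by omega))) h

theorem tau_inv_pow_mul_tau_succ_pow_mem_Sdot (cs : CoxeterSystem (BCoxeterMatrix n) W)
    {k c : ℕ} (hk : k + 1 ≤ n) (hc : c ≤ k) :
    (tau cs k)⁻¹ ^ c * tau cs (k + 1) ^ c ∈ Sdot cs := by
  induction c with
  | zero => simp
  | succ c ih =>
    have h : (tau cs k)⁻¹ ^ (c + 1) * tau cs (k + 1) ^ (c + 1) =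
        ((tau cs k)⁻¹ ^ c * sgen cs k * tau cs k ^ c) *
          ((tau cs k)⁻¹ ^ c * tau cs (k + 1) ^ c) := by
      rw [pow_succ _ c, pow_succ' (tau cs (k + 1)) c, inv_pow]
      simp only [mul_assoc, mul_inv_cancel_left]
      rw [← mul_assoc _ (tau cs (k + 1)), tau_succ, inv_mul_cancel_left]
    rw [h]
    exact mul_mem (conj_sgen_tau_pow_mem_Sdot cs hk hc) (ih (by omega))

theorem tau_inv_pow_mul_tau_pow_mem_Sdot (cs : CoxeterSystem (BCoxeterMatrix n) W)
    {k l c : ℕ} (hkl : k ≤ l) (hl : l ≤ n) (hc : c ≤ k) :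
    (tau cs k)⁻¹ ^ c * tau cs l ^ c ∈ Sdot cs := by
  induction l, hkl using Nat.le_induction with
  | base => simp
  | succ l hkl ih =>
    have h := mul_mem (ih (by omega))
      (tau_inv_pow_mul_tau_succ_pow_mem_Sdot cs hl (hc.trans hkl))
    rwa [mul_assoc, inv_pow (tau cs l), mul_inv_cancel_left] at h

/-- The action of the reflection `s_i` on sign vectors: `s_0` flips the sign at `0`, and `s_i`
exchanges the signs at `i - 1` and `i`. -/
def signRefl : ℕ → (ℕ → Bool) → ℕ → Bool
  | 0, ε, j => if j = 0 then !ε 0 else ε j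
  | i + 1, ε, j => ε (if j = i then i + 1 else if j = i + 1 then i else j)

theorem signRefl_signRefl (a : ℕ) (ε : ℕ → Bool) : signRefl a (signRefl a ε) = ε := by
  funext j
  rcases a with _ | a
  · simp +contextual [signRefl]
  · simp only [signRefl]
    congr 1
    split_ifs <;> omega

theorem signRefl_comm {a b : ℕ} (h : a + 2 ≤ b) (ε : ℕ → Bool) :
    signRefl a (signRefl b ε) = signRefl b (signRefl a ε) := by
  funext j
  obtain ⟨b, rfl⟩ : ∃ c, b = c + 1 := ⟨b - 1, by omega⟩
  rcases a with _ | a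
  · simp only [signRefl]
    grind
  · simp only [signRefl]
    congr 1
    split_ifs <;> omega

theorem signRefl_braid {a : ℕ} (ha : a ≠ 0) (ε : ℕ → Bool) :
    signRefl a (signRefl (a + 1) (signRefl a ε)) =
      signRefl (a + 1) (signRefl a (signRefl (a + 1) ε)) := by
  funext j
  obtain ⟨a, rfl⟩ : ∃ c, a = c + 1 := ⟨a - 1, by omega⟩
  simp only [signRefl]
  congr 1
  grind

theorem signRefl_braid_zero (ε : ℕ → Bool) :
    signRefl 0 (signRefl 1 (signRefl 0 (signRefl 1 ε))) =
      signRefl 1 (signRefl 0 (signRefl 1 (signRefl 0 ε))) := by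
  funext j
  rcases j with _ | _ | j <;> simp [signRefl]

theorem signRefl_isLiftable (n : ℕ) :
    CoxeterMatrix.IsLiftable (G := Function.End (ℕ → Bool)) (BCoxeterMatrix n)
      (fun i : Fin n => signRefl i) := by
  intro a b
  simp only [BCoxeterMatrix, Matrix.of_apply, Fin.ext_iff]
  generalize (a : ℕ) = a
  generalize (b : ℕ) = b
  split_ifs with h1 h2 h3 <;> funext ε
  · subst h1
    exact signRefl_signRefl a ε
  · change signRefl a (signRefl b (signRefl a (signRefl b (signRefl a (signRefl b
      (signRefl a (signRefl b ε))))))) = ε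
    rcases h2 with ⟨rfl, rfl⟩ | ⟨rfl, rfl⟩
    · simp only [signRefl_braid_zero, signRefl_signRefl]
    · simp only [← signRefl_braid_zero, signRefl_signRefl]
  · change signRefl a (signRefl b (signRefl a (signRefl b (signRefl a (signRefl b ε))))) = ε
    rcases h3 with rfl | rfl
    · rw [signRefl_braid (by omega) (signRefl (b + 1) _)]
      simp only [signRefl_signRefl]
    · rw [signRefl_braid (by omega)]
      simp only [signRefl_signRefl]
  · change signRefl a (signRefl b (signRefl a (signRefl b ε))) = ε
    rcases (show a + 2 ≤ b ∨ b + 2 ≤ a by omega) with h | h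
    · simp only [signRefl_comm h, signRefl_signRefl]
    · simp only [← signRefl_comm h, signRefl_signRefl]

/-- The action of a Coxeter group of type `Bₙ` on sign vectors. -/
def signAction (cs : CoxeterSystem (BCoxeterMatrix n) W) : W →* Function.End (ℕ → Bool) :=
  cs.lift ⟨_, signRefl_isLiftable n⟩

theorem signAction_sgen (cs : CoxeterSystem (BCoxeterMatrix n) W) {j : ℕ} (hj : j < n) :
    signAction cs (sgen cs j) = signRefl j := by
  rw [sgen, dif_pos hj]
  exact cs.lift_apply_simple (signRefl_isLiftable n) ⟨j, hj⟩

theorem signAction_mul_apply (cs : CoxeterSystem (BCoxeterMatrix n) W) (x y : W) (ε : ℕ → Bool) :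
    signAction cs (x * y) ε = signAction cs x (signAction cs y ε) := by
  rw [map_mul]; rfl

theorem signAction_one_apply (cs : CoxeterSystem (BCoxeterMatrix n) W) (ε : ℕ → Bool) :
    signAction cs 1 ε = ε := by
  rw [map_one]; rfl

theorem signAction_inv_apply_eq (cs : CoxeterSystem (BCoxeterMatrix n) W) {x : W}
    {ε δ : ℕ → Bool} (h : signAction cs x ε = δ) : signAction cs x⁻¹ δ = ε := by
  rw [← h, ← signAction_mul_apply, inv_mul_cancel, signAction_one_apply]

theorem signAction_apply_of_mem_Sdot (cs : CoxeterSystem (BCoxeterMatrix n) W) {x : W}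
    (hx : x ∈ Sdot cs) : signAction cs x (fun _ => false) = fun _ => false := by
  unfold Sdot at hx
  induction hx using Subgroup.closure_induction with
  | mem x hx =>
    obtain ⟨j, hj, rfl⟩ := hx
    have h := signAction_sgen cs j.2
    simp only [sgen, j.2, dif_pos] at h
    rw [h]
    funext l
    obtain ⟨c, hc⟩ := Nat.exists_eq_succ_of_ne_zero hj
    simp [hc, signRefl]
  | one => exact signAction_one_apply cs _
  | mul x y _ _ hx hy => rw [signAction_mul_apply, hy, hx]
  | inv x _ hx => exact signAction_inv_apply_eq cs hx

theorem signAction_tau_apply (cs : CoxeterSystem (BCoxeterMatrix n) W) {k : ℕ} (hk : k ≤ n)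
    (ε : ℕ → Bool) (j : ℕ) :
    signAction cs (tau cs k) ε j =
      if k ≤ j then ε j else if j = 0 then !ε (k - 1) else ε (j - 1) := by
  induction k generalizing ε with
  | zero => simp [tau_zero, signAction_one_apply]
  | succ k ih =>
    rw [tau_succ, signAction_mul_apply, ih (by omega), signAction_sgen cs (by omega)]
    rcases k with _ | k <;> simp only [signRefl] <;> grind

/-- The orbit of the zero sign vector under `τ_k`, indexed by exponents. -/
def signOrbit (k : ℕ) (c : ℤ) : ℕ → Bool := fun j =>
  decide (j < k ∧ Even ((c - 1 - j) / (k : ℤ)))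

theorem signAction_tau_signOrbit (cs : CoxeterSystem (BCoxeterMatrix n) W) {k : ℕ} (hk : k ≤ n)
    (c : ℤ) : signAction cs (tau cs k) (signOrbit k c) = signOrbit k (c + 1) := by
  funext j
  rw [signAction_tau_apply cs hk]
  simp only [signOrbit]
  split_ifs with h1 h2
  · simp [h1.not_gt]
  · subst h2
    have hk0 : (k : ℤ) ≠ 0 := by omega
    have h : (c - 1 - ((k - 1 : ℕ) : ℤ)) / (k : ℤ) = c / k - 1 := by
      rw [show c - 1 - ((k - 1 : ℕ) : ℤ) = c + (-1) * k by omega, Int.add_mul_ediv_right _ _ hk0]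
      ring
    simp only [h, Int.even_sub_one]
    have hk1 : k - 1 < k := by omega
    have hk2 : 0 < k := by omega
    simp [hk1, hk2, - Int.not_even_iff_odd]
  · have h : c + 1 - 1 - (j : ℤ) = c - 1 - ((j - 1 : ℕ) : ℤ) := by omega
    rw [h]
    have h3 : j - 1 < k := by omega
    have h4 : j < k := by omega
    simp [h3, h4]

theorem signAction_tau_zpow_signOrbit (cs : CoxeterSystem (BCoxeterMatrix n) W) {k : ℕ}
    (hk : k ≤ n) (i c : ℤ) :
    signAction cs (tau cs k ^ i) (signOrbit k c) = signOrbit k (c + i) := by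
  induction i generalizing c with
  | zero => simp [signAction_one_apply]
  | succ i ih =>
    rw [zpow_add_one, signAction_mul_apply, signAction_tau_signOrbit cs hk, ih]
    congr 1; ring
  | pred i ih =>
    have h : signAction cs (tau cs k) (signOrbit k (c - 1)) = signOrbit k c := by
      rw [signAction_tau_signOrbit cs hk, sub_add_cancel]
    rw [zpow_sub_one, signAction_mul_apply, signAction_inv_apply_eq cs h, ih]
    congr 1; ring

theorem signAction_tau_zpow_apply_of_le (cs : CoxeterSystem (BCoxeterMatrix n) W) {k j : ℕ}
    (hk : k ≤ n) (hj : k ≤ j) (i : ℤ) (ε : ℕ → Bool) :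
    signAction cs (tau cs k ^ i) ε j = ε j := by
  have h (ε) : signAction cs (tau cs k) ε j = ε j := by
    rw [signAction_tau_apply cs hk, if_pos hj]
  induction i generalizing ε with
  | zero => simp [signAction_one_apply]
  | succ i ih => rw [zpow_add_one, signAction_mul_apply, ih, h]
  | pred i ih =>
    rw [zpow_sub_one, signAction_mul_apply, ih, ← h (signAction cs (tau cs k)⁻¹ ε),
      ← signAction_mul_apply, mul_inv_cancel, signAction_one_apply]

theorem signOrbit_eq (k : ℕ) {c : ℤ} (h0 : 0 ≤ c) (hc : c ≤ k) :
    signOrbit k c = fun j : ℕ => decide ((j : ℤ) < c) := by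
  funext j
  simp only [signOrbit, decide_eq_decide]
  constructor
  · rintro ⟨hj, he⟩
    by_contra! h
    have h' : (c - 1 - j) / (k : ℤ) = -1 := by
      rw [Int.ediv_eq_iff_of_pos (by omega)]
      constructor <;> linarith
    rw [h'] at he
    exact absurd he (by decide)
  · intro h
    refine ⟨by omega, ?_⟩
    rw [Int.ediv_eq_zero_of_lt (by omega) (by omega)]
    exact Even.zero

theorem mem_Ico_of_signOrbit_pred_eq_false {k : ℕ} {c : ℤ} (hk : 1 ≤ k) (h0 : -(k : ℤ) ≤ c)
    (hc : c < 2 * k) (h : signOrbit k c (k - 1) = false) : 0 ≤ c ∧ c < k := by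
  have hk1 : k - 1 < k := by omega
  have hc1 : c - 1 - ((k - 1 : ℕ) : ℤ) = c - k := by omega
  simp only [signOrbit, hk1, true_and, decide_eq_false_iff_not, hc1] at h
  constructor
  · by_contra! hlt
    have h' : (c - k) / (k : ℤ) = -2 := by
      rw [Int.ediv_eq_iff_of_pos (by omega)]
      constructor <;> linarith
    rw [h'] at h
    exact h (by decide)
  · by_contra! hlt
    have h' : (c - k) / (k : ℤ) = 0 := Int.ediv_eq_zero_of_lt (by omega) (by omega)
    rw [h'] at h
    exact h (by decide)

/-- The product of the first `r` factors `τ_{k_j}^{i_j}`. -/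
def tauProd (cs : CoxeterSystem (BCoxeterMatrix n) W) (k : ℕ → ℕ) (i : ℕ → ℤ) (r : ℕ) : W :=
  ((List.range r).map fun j => tau cs (k j) ^ i j).prod

theorem tauProd_zero (cs : CoxeterSystem (BCoxeterMatrix n) W) (k : ℕ → ℕ) (i : ℕ → ℤ) :
    tauProd cs k i 0 = 1 := by
  simp [tauProd]

theorem tauProd_succ (cs : CoxeterSystem (BCoxeterMatrix n) W) (k : ℕ → ℕ) (i : ℕ → ℤ) (r : ℕ) :
    tauProd cs k i (r + 1) = tauProd cs k i r * tau cs (k r) ^ i r := by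
  simp [tauProd, List.range_succ]

theorem signAction_tauProd_inv_apply (cs : CoxeterSystem (BCoxeterMatrix n) W) {k : ℕ → ℕ}
    {i : ℕ → ℤ} {r j : ℕ} (hkn : ∀ l < r, k l ≤ n) (hj : ∀ l < r, k l ≤ j) (ε : ℕ → Bool) :
    signAction cs (tauProd cs k i r)⁻¹ ε j = ε j := by
  induction r with
  | zero => simp [tauProd_zero, signAction_one_apply]
  | succ r ih =>
    rw [tauProd_succ, mul_inv_rev, signAction_mul_apply, ← zpow_neg,
      signAction_tau_zpow_apply_of_le cs (hkn r (by omega)) (hj r (by omega)),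
      ih (fun l hl => hkn l (by omega)) (fun l hl => hj l (by omega))]

/-- Necessity: `C r` is the sum of the exponents `i_j` with `r ≤ j < m`. -/
theorem bounds_of_tauProd_mem_Sdot (cs : CoxeterSystem (BCoxeterMatrix n) W) {m : ℕ} {k : ℕ → ℕ}
    {i C : ℕ → ℤ} (hk1 : ∀ j < m, 1 ≤ k j) (hkn : ∀ j < m, k j ≤ n)
    (hmono : ∀ j l, j < l → l < m → k j < k l)
    (hlb : ∀ j < m, -(k j : ℤ) ≤ i j) (hub : ∀ j < m, i j ≤ (k j : ℤ) - 1)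
    (hC : ∀ r < m, C r = i r + C (r + 1)) (hCm : C m = 0) (hw : tauProd cs k i m ∈ Sdot cs) :
    C 0 = 0 ∧ ∀ r, 1 ≤ r → r < m → 0 ≤ C r ∧ C r ≤ k (r - 1) := by
  have upper {r : ℕ} (hr : r ≤ m) (h1 : 1 ≤ r) (h : signAction cs (tauProd cs k i r)⁻¹
      (fun _ => false) = fun j : ℕ => decide ((j : ℤ) < C r)) : C r ≤ k (r - 1) := by
    have h2 := congrFun h (k (r - 1))
    rw [signAction_tauProd_inv_apply cs (fun l hl => hkn l (by omega))] at h2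
    · simpa using h2.symm
    · intro l hl
      rcases (show l ≤ r - 1 by omega).eq_or_lt with rfl | hlt
      · rfl
      · exact (hmono _ _ hlt (by omega)).le
  have key : ∀ r ≤ m, 0 ≤ C r ∧ signAction cs (tauProd cs k i r)⁻¹ (fun _ => false) =
      fun j : ℕ => decide ((j : ℤ) < C r) := by
    intro r hr
    induction hr using Nat.decreasingInduction with
    | self =>
      refine ⟨hCm.ge, ?_⟩
      rw [signAction_apply_of_mem_Sdot cs (inv_mem hw), hCm]
      funext j
      simp
    | of_succ r hr ih =>
      obtain ⟨h0, h⟩ := ih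
      have hc : C (r + 1) ≤ k r := upper hr (by omega) h
      have h' : signAction cs (tauProd cs k i r)⁻¹ (fun _ => false) = signOrbit (k r) (C r) := by
        rw [← signOrbit_eq (k r) h0 hc] at h
        rw [hC r hr, add_comm, ← signAction_tau_zpow_signOrbit cs (hkn r hr), ← h,
          ← signAction_mul_apply, tauProd_succ, mul_inv_rev, mul_inv_cancel_left]
      have hb := hlb r hr
      have hb' := hub r hr
      have hCr := hC r hr
      obtain ⟨h1, h2⟩ := mem_Ico_of_signOrbit_pred_eq_false (c := C r) (hk1 r hr) (by omega)
        (by omega) (by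
          rw [← h', signAction_tauProd_inv_apply cs (fun l hl => hkn l (by omega))]
          intro l hl
          have := hmono l r hl hr
          omega)
      exact ⟨h1, h'.trans (signOrbit_eq (k r) h1 h2.le)⟩
  refine ⟨?_, fun r h1 hr => ⟨(key r hr.le).1, upper hr.le h1 (key r hr.le).2⟩⟩
  obtain ⟨h0, h⟩ := key 0 (Nat.zero_le _)
  have h2 := congrFun h 0
  rw [tauProd_zero, inv_one, signAction_one_apply] at h2
  have : C 0 ≤ 0 := by simpa using h2.symm
  omega

/-- Sufficiency: `C r` is the sum of the exponents `i_j` with `r ≤ j < m`. -/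
theorem tauProd_mem_Sdot_of_bounds (cs : CoxeterSystem (BCoxeterMatrix n) W) {m : ℕ} {k : ℕ → ℕ}
    {i C : ℕ → ℤ} (hkn : ∀ j < m, k j ≤ n) (hmono : ∀ j l, j < l → l < m → k j < k l)
    (hC : ∀ r < m, C r = i r + C (r + 1)) (hCm : C m = 0)
    (h0 : C 0 = 0) (hb : ∀ r, 1 ≤ r → r < m → 0 ≤ C r ∧ C r ≤ k (r - 1)) :
    tauProd cs k i m ∈ Sdot cs := by
  have key : ∀ r < m, tauProd cs k i (r + 1) * tau cs (k r) ^ C (r + 1) ∈ Sdot cs := by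
    intro r hr
    induction r with
    | zero =>
      rw [tauProd_succ, tauProd_zero, one_mul, ← zpow_add, ← hC 0 hr, h0, zpow_zero]
      exact one_mem _
    | succ r ih =>
      obtain ⟨h1, h2⟩ := hb (r + 1) (by omega) hr
      rw [tauProd_succ, mul_assoc, ← zpow_add, ← hC (r + 1) hr]
      have hr' := ih (by omega)
      rw [Nat.add_sub_cancel] at h2
      lift C (r + 1) to ℕ using h1 with c
      rw [zpow_natCast] at hr' ⊢
      have h := mul_mem hr' (tau_inv_pow_mul_tau_pow_mem_Sdot cs (c := c)
        (hmono r (r + 1) (by omega) hr).le (hkn (r + 1) hr) (by omega))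
      rwa [mul_assoc, inv_pow, mul_inv_cancel_left] at h
  rcases m with _ | m
  · rw [tauProd_zero]
    exact one_mem _
  · simpa [hCm] using key m (by omega)

/-- Let `w ≠ 1` be presented as `w = τ_{k_1}^{i_{k_1}} ⋯ τ_{k_m}^{i_{k_m}}` with
`1 ≤ k_1 < ⋯ < k_m ≤ n` and nonzero `i_{k_j}` with `-k_j ≤ i_{k_j} ≤ k_j - 1`.
Then `w ∈ Ṡ_n` iff `Σ_{j=1}^m i_{k_j} = 0` and `0 ≤ Σ_{j=r}^m i_{k_j} ≤ k_{r-1}`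
for every `2 ≤ r ≤ m`; moreover, when these conditions hold, `i_{k_1} < 0`. -/
theorem mem_Sdot_iff (cs : CoxeterSystem (BCoxeterMatrix n) W) (w : W) (hw : w ≠ 1)
    (m : ℕ) (k : Fin m → ℕ) (i : Fin m → ℤ)
    (hk1 : ∀ j, 1 ≤ k j) (hkn : ∀ j, k j ≤ n) (hmono : StrictMono k)
    (hne : ∀ j, i j ≠ 0) (hlb : ∀ j, -(k j : ℤ) ≤ i j) (hub : ∀ j, i j ≤ (k j : ℤ) - 1)
    (hw_eq : w = ((List.finRange m).map (fun j => tau cs (k j) ^ i j)).prod) :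
    (w ∈ Sdot cs ↔
      ((∑ j, i j = 0) ∧
        ∀ r : ℕ, 1 ≤ r → ∀ hr : r < m,
          0 ≤ (∑ j ∈ Finset.univ.filter (fun j : Fin m => r ≤ (j : ℕ)), i j) ∧
          (∑ j ∈ Finset.univ.filter (fun j : Fin m => r ≤ (j : ℕ)), i j) ≤
            (k ⟨r - 1, Nat.lt_of_le_of_lt (Nat.sub_le r 1) hr⟩ : ℤ))) ∧
    (((∑ j, i j = 0) ∧
        ∀ r : ℕ, 1 ≤ r → ∀ hr : r < m,
          0 ≤ (∑ j ∈ Finset.univ.filter (fun j : Fin m => r ≤ (j : ℕ)), i j) ∧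
          (∑ j ∈ Finset.univ.filter (fun j : Fin m => r ≤ (j : ℕ)), i j) ≤
            (k ⟨r - 1, Nat.lt_of_le_of_lt (Nat.sub_le r 1) hr⟩ : ℤ)) →
      ∀ hm : 0 < m, i ⟨0, hm⟩ < 0) := by
  set C : ℕ → ℤ := fun r => ∑ j ∈ Finset.univ.filter (fun j : Fin m => r ≤ (j : ℕ)), i j with hCdef
  set K : ℕ → ℕ := fun j => if h : j < m then k ⟨j, h⟩ else 0 with hK
  set I : ℕ → ℤ := fun j => if h : j < m then i ⟨j, h⟩ else 0 with hI
  have hKe (j) (h : j < m) : K j = k ⟨j, h⟩ := dif_pos h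
  have hIe (j) (h : j < m) : I j = i ⟨j, h⟩ := dif_pos h
  have hC : ∀ r < m, C r = I r + C (r + 1) := by
    intro r hr
    have : Finset.univ.filter (fun j : Fin m => r ≤ (j : ℕ)) =
        insert ⟨r, hr⟩ (Finset.univ.filter (fun j : Fin m => r + 1 ≤ (j : ℕ))) := by
      ext j
      simp only [Finset.mem_filter, Finset.mem_univ, true_and, Finset.mem_insert, Fin.ext_iff]
      omega
    simp only [hCdef]
    rw [this, Finset.sum_insert (by simp), hIe r hr]
  have hCm : C m = 0 := Finset.sum_eq_zero fun j hj => by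
    have := (Finset.mem_filter.1 hj).2
    omega
  have hsum : ∑ j, i j = C 0 := by simp [hCdef]
  have hprod : w = tauProd cs K I m := by
    rw [hw_eq, tauProd, ← List.map_coe_finRange_eq_range, List.map_map]
    congr 1
    refine List.map_congr_left fun j _ => ?_
    simp [hKe j j.2, hIe j j.2]
  have hkn' : ∀ j < m, K j ≤ n := fun j hj => by rw [hKe j hj]; exact hkn _
  have hmono' : ∀ j l, j < l → l < m → K j < K l := fun j l hjl hl => by
    rw [hKe j (hjl.trans hl), hKe l hl]; exact hmono hjl
  rw [hsum, hprod]
  refine ⟨⟨fun h => ?_, fun ⟨h0, hb⟩ => ?_⟩, fun ⟨h0, hb⟩ hm => ?_⟩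
  · obtain ⟨h0, hb⟩ := bounds_of_tauProd_mem_Sdot cs (C := C)
      (fun j hj => by rw [hKe j hj]; exact hk1 _) hkn' hmono'
      (fun j hj => by rw [hKe j hj, hIe j hj]; exact hlb _)
      (fun j hj => by rw [hKe j hj, hIe j hj]; exact hub _) hC hCm h
    refine ⟨h0, fun r h1 hr => ?_⟩
    rw [← hKe]
    exact hb r h1 hr
  · refine tauProd_mem_Sdot_of_bounds cs hkn' hmono' hC hCm h0 fun r h1 hr => ?_
    rw [hKe (r - 1) (by omega)]
    exact hb r h1 hr
  · have h1 : 0 ≤ C 1 := by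
      rcases (show 1 ≤ m from hm).eq_or_lt with rfl | h
      · exact hCm.ge
      · exact (hb 1 le_rfl h).1
    have h2 := hC 0 hm
    rw [hIe 0 hm] at h2
    have := hne ⟨0, hm⟩
    grind
end

section
/- Let w ∈ W have an Ṡ_n-admissible presentation w = τ_{k_1}^{i_{k_1}}·τ_{k_2}^{i_{k_2}}⋯τ_{k_m}^{i_{k_m}}. Then the cardinality of the left descent set des(w) equals the number of indices j with 1 ≤ j ≤ m such that i_{k_j} < 0. (By the results of Shwartz for the symmetric group, this cardinality equals the number z(w) of factors in the standard OGS elementary factorization of w.) -/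
variable {n : ℕ} {W : Type*} [Group W]

/-- An `Ṡ_n`-admissible presentation of `w ∈ W`: an expression
`w = τ_{k_1}^{i_{k_1}} ⋯ τ_{k_m}^{i_{k_m}}` with `1 ≤ k_1 < ⋯ < k_m ≤ n` and
nonzero integers `i_{k_j}` such that `-k_j ≤ i_{k_j} ≤ k_j - 1` for all `j`,
`Σ_{j=1}^m i_{k_j} = 0`, and `0 ≤ Σ_{j=r}^m i_{k_j} ≤ k_{r-1}` for all `2 ≤ r ≤ m`. -/
structure IsAdmissible (cs : CoxeterSystem (BCoxeterMatrix n) W) (w : W)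
    (m : ℕ) (k : Fin m → ℕ) (i : Fin m → ℤ) : Prop where
  one_le : ∀ j, 1 ≤ k j
  le_n : ∀ j, k j ≤ n
  mono : StrictMono k
  ne_zero : ∀ j, i j ≠ 0
  lb : ∀ j, -(k j : ℤ) ≤ i j
  ub : ∀ j, i j ≤ (k j : ℤ) - 1
  total : ∑ j, i j = 0
  partialSum : ∀ r : ℕ, 1 ≤ r → ∀ hr : r < m,
    0 ≤ (∑ j ∈ Finset.univ.filter (fun j : Fin m => r ≤ (j : ℕ)), i j) ∧
    (∑ j ∈ Finset.univ.filter (fun j : Fin m => r ≤ (j : ℕ)), i j) ≤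
      (k ⟨r - 1, Nat.lt_of_le_of_lt (Nat.sub_le r 1) hr⟩ : ℤ)
  prod_eq : w = ((List.finRange m).map (fun j => tau cs (k j) ^ i j)).prod

/-- The action of the simple reflection `s_j` on integer sequences: `s_0` negates the entry at
position `0`, and `s_j` exchanges the entries at positions `j - 1` and `j` for `j ≥ 1`. -/
def reflectSeq (j : ℕ) (f : ℕ → ℤ) (p : ℕ) : ℤ :=
  if j = 0 then (if p = 0 then -f 0 else f p)
  else if p = j then f (j - 1) else if p + 1 = j then f j else f p

theorem reflectSeq_involutive (j : ℕ) : Function.Involutive (reflectSeq j) := by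
  intro f
  funext p
  simp only [reflectSeq]
  grind

/-- The pairing of a sequence with the simple root `α_j`. -/
def rootPairing (j : ℕ) (f : ℕ → ℤ) : ℤ :=
  if j = 0 then f 0 else f j - f (j - 1)

theorem rootPairing_reflectSeq_self (j : ℕ) (f : ℕ → ℤ) :
    rootPairing j (reflectSeq j f) = -rootPairing j f := by
  simp only [reflectSeq, rootPairing]
  grind

theorem rootPairing_reflectSeq_of_orthogonal {a b : ℕ} (h : a + 2 ≤ b ∨ b + 2 ≤ a) (f : ℕ → ℤ) :
    rootPairing a (reflectSeq b f) = rootPairing a f := by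
  simp only [reflectSeq, rootPairing]
  grind

theorem rootPairing_reflectSeq_of_adjacent {a b : ℕ} (ha : a ≠ 0) (hb : b ≠ 0)
    (h : b + 1 = a ∨ a + 1 = b) (f : ℕ → ℤ) :
    rootPairing a (reflectSeq b f) = rootPairing a f + rootPairing b f := by
  simp only [reflectSeq, rootPairing]
  grind

theorem rootPairing_zero_reflectSeq_one (f : ℕ → ℤ) :
    rootPairing 0 (reflectSeq 1 f) = rootPairing 0 f + rootPairing 1 f := by
  simp only [reflectSeq, rootPairing]
  grind

theorem rootPairing_one_reflectSeq_zero (f : ℕ → ℤ) :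
    rootPairing 1 (reflectSeq 0 f) = rootPairing 1 f + 2 * rootPairing 0 f := by
  simp only [reflectSeq, rootPairing]
  grind

theorem reflectSeq_comm {a b : ℕ} (h : a + 2 ≤ b) (f : ℕ → ℤ) :
    reflectSeq a (reflectSeq b f) = reflectSeq b (reflectSeq a f) := by
  funext p
  simp only [reflectSeq]
  grind

theorem reflectSeq_braid {a : ℕ} (h : 1 ≤ a) (f : ℕ → ℤ) :
    reflectSeq a (reflectSeq (a + 1) (reflectSeq a f)) =
      reflectSeq (a + 1) (reflectSeq a (reflectSeq (a + 1) f)) := by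
  funext p
  simp only [reflectSeq]
  grind

theorem reflectSeq_zero_one (f : ℕ → ℤ) :
    reflectSeq 0 (reflectSeq 1 (reflectSeq 0 (reflectSeq 1 f))) =
      reflectSeq 1 (reflectSeq 0 (reflectSeq 1 (reflectSeq 0 f))) := by
  funext p
  simp only [reflectSeq]
  grind

/-- The permutation of the set of integer sequences given by `reflectSeq j`. -/
def reflectPerm (j : ℕ) : Equiv.Perm (ℕ → ℤ) :=
  (reflectSeq_involutive j).toPerm

theorem reflectPerm_mul_self (j : ℕ) : reflectPerm j * reflectPerm j = 1 := by
  ext1 f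
  exact reflectSeq_involutive j f

theorem mul_pow_two_eq_one {G : Type*} [Group G] {a b : G} (ha : a * a = 1) (hb : b * b = 1)
    (h : a * b = b * a) : (a * b) ^ 2 = 1 := by
  rw [pow_two]; nth_rw 2 [h]
  rw [mul_assoc, ← mul_assoc b b, hb, one_mul, ha]

theorem mul_pow_three_eq_one {G : Type*} [Group G] {a b : G} (ha : a * a = 1) (hb : b * b = 1)
    (h : a * b * a = b * a * b) : (a * b) ^ 3 = 1 := by
  have : (a * b) ^ 3 = (a * b * a) * (b * a * b) := by simp only [pow_succ, pow_zero]; group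
  rw [this, ← h, show a * b * a * (a * b * a) = a * (b * (a * a) * b) * a by group, ha, mul_one,
    hb, mul_one, ha]

theorem mul_pow_four_eq_one {G : Type*} [Group G] {a b : G} (ha : a * a = 1) (hb : b * b = 1)
    (h : a * b * a * b = b * a * b * a) : (a * b) ^ 4 = 1 := by
  have : (a * b) ^ 4 = (a * b * a * b) * (a * b * a * b) := by
    simp only [pow_succ, pow_zero]; group
  rw [this]; nth_rw 2 [h]
  rw [show a * b * a * b * (b * a * b * a) = a * (b * (a * (b * b) * a) * b) * a by group, hb,
    mul_one, ha, mul_one, hb, mul_one, ha]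

theorem reflectPerm_isLiftable (n : ℕ) :
    (BCoxeterMatrix n).IsLiftable (fun j : Fin n => reflectPerm j) := by
  have h2 : ∀ a b : ℕ, a + 2 ≤ b → reflectPerm a * reflectPerm b =
      reflectPerm b * reflectPerm a := fun a b h => by ext1 f; exact reflectSeq_comm h f
  have h3 : ∀ a : ℕ, 1 ≤ a → reflectPerm a * reflectPerm (a + 1) * reflectPerm a =
      reflectPerm (a + 1) * reflectPerm a * reflectPerm (a + 1) :=
    fun a h => by ext1 f; exact reflectSeq_braid h f
  have h4 : reflectPerm 0 * reflectPerm 1 * reflectPerm 0 * reflectPerm 1 =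
      reflectPerm 1 * reflectPerm 0 * reflectPerm 1 * reflectPerm 0 := by
    ext1 f; exact reflectSeq_zero_one f
  have hs := reflectPerm_mul_self
  intro a b
  change (reflectPerm a * reflectPerm b) ^ (if a = b then 1
      else if ((a : ℕ) = 0 ∧ (b : ℕ) = 1) ∨ ((b : ℕ) = 0 ∧ (a : ℕ) = 1) then 4
      else if (b : ℕ) + 1 = a ∨ (a : ℕ) + 1 = b then 3 else 2) = 1
  split_ifs with e e4 e3
  · rw [e, pow_one, hs]
  · apply mul_pow_four_eq_one (hs _) (hs _)
    rcases e4 with ⟨ha, hb⟩ | ⟨hb, ha⟩ <;> rw [ha, hb]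
    · exact h4
    · exact h4.symm
  · apply mul_pow_three_eq_one (hs _) (hs _)
    rcases e3 with hab | hab <;> rw [← hab]
    · exact (h3 _ (by omega)).symm
    · exact h3 _ (by omega)
  · apply mul_pow_two_eq_one (hs _) (hs _)
    have : (a : ℕ) ≠ b := fun h => e (Fin.ext h)
    rcases Nat.lt_or_gt_of_ne this with hab | hab
    · exact h2 _ _ (by omega)
    · exact (h2 _ _ (by omega)).symm

/-- The action of a Coxeter group of type `B` on integer sequences. -/
def seqAction (cs : CoxeterSystem (BCoxeterMatrix n) W) : W →* Equiv.Perm (ℕ → ℤ) :=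
  cs.lift ⟨fun j : Fin n => reflectPerm j, reflectPerm_isLiftable n⟩

theorem seqAction_simple_mul (cs : CoxeterSystem (BCoxeterMatrix n) W) (j : Fin n) (w : W)
    (f : ℕ → ℤ) : seqAction cs (cs.simple j * w) f = reflectSeq j (seqAction cs w f) := by
  rw [map_mul, seqAction, cs.lift_apply_simple]
  rfl

theorem seqAction_sgen (cs : CoxeterSystem (BCoxeterMatrix n) W) {j : ℕ} (hj : j < n)
    (f : ℕ → ℤ) : seqAction cs (sgen cs j) f = reflectSeq j f := by
  rw [sgen, dif_pos hj, ← mul_one (cs.simple _), seqAction_simple_mul]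
  simp

/-- The sequence `1, 2, 3, …`, a point in the interior of the fundamental chamber. -/
def baseSeq (p : ℕ) : ℤ := p + 1

theorem rootPairing_baseSeq_pos (j : ℕ) : 0 < rootPairing j baseSeq := by
  simp only [rootPairing, baseSeq]
  grind

theorem simple_comm (cs : CoxeterSystem (BCoxeterMatrix n) W) {s t : Fin n}
    (h : (BCoxeterMatrix n) s t = 2) :
    cs.simple s * cs.simple t = cs.simple t * cs.simple s := by
  have := cs.simple_mul_simple_pow s t
  rw [h, pow_two, mul_eq_one_iff_eq_inv] at this
  simpa using this

theorem simple_braid_three (cs : CoxeterSystem (BCoxeterMatrix n) W) {s t : Fin n}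
    (h : (BCoxeterMatrix n) s t = 3) :
    cs.simple s * (cs.simple t * cs.simple s) = cs.simple t * (cs.simple s * cs.simple t) := by
  have := cs.simple_mul_simple_pow s t
  rw [h, show (cs.simple s * cs.simple t) ^ 3 = (cs.simple s * (cs.simple t * cs.simple s)) *
    (cs.simple t * (cs.simple s * cs.simple t)) by simp only [pow_succ, pow_zero]; group,
    mul_eq_one_iff_eq_inv] at this
  simpa [mul_assoc] using this

theorem simple_braid_four (cs : CoxeterSystem (BCoxeterMatrix n) W) {s t : Fin n}
    (h : (BCoxeterMatrix n) s t = 4) :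
    cs.simple s * (cs.simple t * (cs.simple s * cs.simple t)) =
      cs.simple t * (cs.simple s * (cs.simple t * cs.simple s)) := by
  have := cs.simple_mul_simple_pow s t
  rw [h, show (cs.simple s * cs.simple t) ^ 4 =
    (cs.simple s * (cs.simple t * (cs.simple s * cs.simple t))) *
    (cs.simple s * (cs.simple t * (cs.simple s * cs.simple t))) by
      simp only [pow_succ, pow_zero]; group, mul_eq_one_iff_eq_inv] at this
  simpa [mul_assoc] using this

theorem rootPairing_pos_of_not_isLeftDescent (cs : CoxeterSystem (BCoxeterMatrix n) W) (w : W)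
    (s : Fin n) (hs : ¬cs.IsLeftDescent w s) : 0 < rootPairing s (seqAction cs w baseSeq) := by
  induction hl : cs.length w using Nat.strong_induction_on generalizing w s with
  | _ l ih =>
  subst hl
  by_cases hw : w = 1
  · subst hw
    simpa using rootPairing_baseSeq_pos s
  obtain ⟨t, ht⟩ := cs.exists_leftDescent_of_ne_one hw
  have hst : s ≠ t := fun h => hs (h ▸ ht)
  have hcancel (r : Fin n) (x : W) : cs.simple r * (cs.simple r * x) = x := by simp
  have hact (r : Fin n) (x : W) : seqAction cs x baseSeq =
      reflectSeq r (seqAction cs (cs.simple r * x) baseSeq) := by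
    rw [← seqAction_simple_mul, hcancel]
  have hle (r : Fin n) (x : W) : cs.length (cs.simple r * x) ≤ cs.length x + 1 := by
    have := cs.length_mul_le (cs.simple r) x
    rw [cs.length_simple] at this
    omega
  have hdesc (r : Fin n) (x : W) : cs.IsLeftDescent x r →
      cs.length (cs.simple r * x) + 1 = cs.length x := cs.isLeftDescent_iff.1
  have hswap (r : Fin n) (x : W) (h : cs.IsLeftDescent x r) :
      ¬cs.IsLeftDescent (cs.simple r * x) r := by
    unfold CoxeterSystem.IsLeftDescent at *
    rw [hcancel]
    omega
  have hs' := cs.not_isLeftDescent_iff.1 hs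
  have hv := hdesc t w ht
  set v := cs.simple t * w with hvdef
  have hwv : w = cs.simple t * v := (hcancel t w).symm
  have hvt := ih _ (by omega) v t (hswap t w ht) rfl
  have hwact := hact t w
  rw [← hvdef] at hwact
  have hM : (BCoxeterMatrix n) s t = if s = t then 1
      else if ((s : ℕ) = 0 ∧ (t : ℕ) = 1) ∨ ((t : ℕ) = 0 ∧ (s : ℕ) = 1) then 4
      else if (t : ℕ) + 1 = s ∨ (s : ℕ) + 1 = t then 3 else 2 := rfl
  rw [if_neg hst] at hM
  have hne : (s : ℕ) ≠ t := fun h => hst (Fin.ext h)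
  rw [hwact]
  split_ifs at hM with e4 e3
  · by_cases hvs : cs.IsLeftDescent v s
    · have hu := hdesc s v hvs
      set u := cs.simple s * v with hudef
      have hvu : v = cs.simple s * u := (hcancel s v).symm
      have hus := ih _ (by omega) u s (hswap s v hvs) rfl
      rw [hact s v, ← hudef]
      by_cases hut : cs.IsLeftDescent u t
      · have hx := hdesc t u hut
        set x := cs.simple t * u with hxdef
        have hux : u = cs.simple t * x := (hcancel t u).symm
        have hxs : ¬cs.IsLeftDescent x s := by
          intro hxs
          have h1 := hdesc s x hxs
          have h2 : cs.simple s * w =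
              cs.simple t * (cs.simple s * (cs.simple t * (cs.simple s * x))) := by
            rw [hwv, hvu, hux]
            have := congrArg (· * x) (simple_braid_four cs hM)
            simpa only [mul_assoc] using this
          have h3 := hle t (cs.simple s * (cs.simple t * (cs.simple s * x)))
          have h4 := hle s (cs.simple t * (cs.simple s * x))
          have h5 := hle t (cs.simple s * x)
          rw [h2] at hs'
          omega
        have hxpos := ih _ (by omega) x s hxs rfl
        rw [hact t u, ← hxdef]
        rcases e4 with ⟨h0, h1⟩ | ⟨h1, h0⟩ <;>
          simp only [h0, h1, rootPairing_zero_reflectSeq_one, rootPairing_one_reflectSeq_zero,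
            rootPairing_reflectSeq_self] at * <;>
          omega
      · have hut' := ih _ (by omega) u t hut rfl
        rcases e4 with ⟨h0, h1⟩ | ⟨h1, h0⟩ <;>
          simp only [h0, h1, rootPairing_zero_reflectSeq_one, rootPairing_one_reflectSeq_zero,
            rootPairing_reflectSeq_self] at * <;>
          omega
    · have hvs' := ih _ (by omega) v s hvs rfl
      rcases e4 with ⟨h0, h1⟩ | ⟨h1, h0⟩ <;>
        simp only [h0, h1, rootPairing_zero_reflectSeq_one, rootPairing_one_reflectSeq_zero] at * <;>
        omega
  · have hs0 : (s : ℕ) ≠ 0 := by omega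
    have ht0 : (t : ℕ) ≠ 0 := by omega
    by_cases hvs : cs.IsLeftDescent v s
    · have hu := hdesc s v hvs
      set u := cs.simple s * v with hudef
      have hvu : v = cs.simple s * u := (hcancel s v).symm
      have hut : ¬cs.IsLeftDescent u t := by
        intro hut
        have h1 := hdesc t u hut
        have h2 : cs.simple s * w = cs.simple t * (cs.simple s * (cs.simple t * u)) := by
          rw [hwv, hvu]
          have := congrArg (· * u) (simple_braid_three cs hM)
          simpa only [mul_assoc] using this
        have h3 := hle t (cs.simple s * (cs.simple t * u))
        have h4 := hle s (cs.simple t * u)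
        rw [h2] at hs'
        omega
      have hut' := ih _ (by omega) u t hut rfl
      rw [hact s v, ← hudef]
      simp only [rootPairing_reflectSeq_of_adjacent hs0 ht0 e3,
        rootPairing_reflectSeq_of_adjacent ht0 hs0 e3.symm, rootPairing_reflectSeq_self]
      omega
    · have hvs' := ih _ (by omega) v s hvs rfl
      simp only [rootPairing_reflectSeq_of_adjacent hs0 ht0 e3]
      omega
  · have hvs : ¬cs.IsLeftDescent v s := by
      intro hvs
      have h1 := hdesc s v hvs
      have h2 : cs.simple s * w = cs.simple t * (cs.simple s * v) := by
        rw [hwv, ← mul_assoc, simple_comm cs hM, mul_assoc]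
      have h3 := hle t (cs.simple s * v)
      rw [h2] at hs'
      omega
    have hvs' := ih _ (by omega) v s hvs rfl
    rwa [rootPairing_reflectSeq_of_orthogonal (by omega)]

theorem isLeftDescent_iff_rootPairing_neg (cs : CoxeterSystem (BCoxeterMatrix n) W) (w : W)
    (s : Fin n) : cs.IsLeftDescent w s ↔ rootPairing s (seqAction cs w baseSeq) < 0 := by
  refine ⟨fun h => ?_, fun h => ?_⟩
  · have h' : ¬cs.IsLeftDescent (cs.simple s * w) s := by
      unfold CoxeterSystem.IsLeftDescent at *
      rw [cs.simple_mul_simple_cancel_left]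
      omega
    have := rootPairing_pos_of_not_isLeftDescent cs _ s h'
    rw [seqAction_simple_mul, rootPairing_reflectSeq_self] at this
    omega
  · by_contra h'
    have := rootPairing_pos_of_not_isLeftDescent cs w s h'
    omega

/-- Rotation of the first `k` entries of a sequence by `i` places to the right, where an entry
that passes the end of the block changes its sign (for `|i| ≤ k`). -/
def signedRotate (k : ℕ) (i : ℤ) (f : ℕ → ℤ) (p : ℕ) : ℤ :=
  if p < k then
    if (p : ℤ) - i < 0 then -f ((p : ℤ) - i + k).toNat
    else if (k : ℤ) ≤ p - i then -f ((p : ℤ) - i - k).toNat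
    else f ((p : ℤ) - i).toNat
  else f p

theorem seqAction_tau (cs : CoxeterSystem (BCoxeterMatrix n) W) {k : ℕ} (hk : k ≤ n)
    (f : ℕ → ℤ) : seqAction cs (tau cs k) f = signedRotate k 1 f := by
  induction k generalizing f with
  | zero => funext p; simp [tau, signedRotate]
  | succ k ih =>
    have : tau cs (k + 1) = tau cs k * sgen cs k := by simp [tau, List.range_succ]
    rw [this, map_mul, Equiv.Perm.mul_apply, seqAction_sgen cs (by omega), ih (by omega)]
    funext p
    simp only [signedRotate, reflectSeq]
    grind

theorem signedRotate_add_one {k i : ℕ} (hi : i + 1 ≤ k) (f : ℕ → ℤ) :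
    signedRotate k 1 (signedRotate k i f) = signedRotate k (i + 1 : ℕ) f := by
  funext p
  simp only [signedRotate]
  grind

theorem signedRotate_neg {k i : ℕ} (hi : i ≤ k) (f : ℕ → ℤ) :
    signedRotate k i (signedRotate k (-i) f) = f := by
  funext p
  simp only [signedRotate]
  grind

theorem seqAction_tau_pow (cs : CoxeterSystem (BCoxeterMatrix n) W) {k : ℕ} (hk : k ≤ n) {i : ℕ}
    (hi : i ≤ k) (f : ℕ → ℤ) : seqAction cs (tau cs k ^ i) f = signedRotate k i f := by
  induction i with
  | zero =>
    funext p
    simp only [signedRotate, pow_zero, map_one, Equiv.Perm.one_apply]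
    grind
  | succ i ih =>
    rw [pow_succ', map_mul, Equiv.Perm.mul_apply, ih (by omega), seqAction_tau cs hk,
      signedRotate_add_one hi]

theorem seqAction_tau_zpow (cs : CoxeterSystem (BCoxeterMatrix n) W) {k : ℕ} (hk : k ≤ n) {i : ℤ}
    (hi : -(k : ℤ) ≤ i) (hi' : i ≤ k) (f : ℕ → ℤ) :
    seqAction cs (tau cs k ^ i) f = signedRotate k i f := by
  obtain ⟨a, rfl | rfl⟩ := i.eq_nat_or_neg
  · rw [zpow_natCast, seqAction_tau_pow cs hk (by omega)]
  · rw [zpow_neg, zpow_natCast, map_inv, Equiv.Perm.inv_eq_iff_eq,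
      seqAction_tau_pow cs hk (by omega), signedRotate_neg (by omega)]

theorem signedRotate_of_le {k p : ℕ} (hp : k ≤ p) (i : ℤ) (f : ℕ → ℤ) :
    signedRotate k i f p = f p := by
  simp only [signedRotate]
  grind

theorem signedRotate_natCast_of_lt {k a p : ℕ} (hp : p < a) (ha : a ≤ k) (f : ℕ → ℤ) :
    signedRotate k a f p = -f (p + (k - a)) := by
  simp only [signedRotate]
  grind

theorem signedRotate_natCast_of_ge {k a p : ℕ} (hp : a ≤ p) (hpk : p < k) (f : ℕ → ℤ) :
    signedRotate k a f p = f (p - a) := by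
  simp only [signedRotate]
  grind

theorem signedRotate_neg_natCast_of_lt {k a p : ℕ} (hp : p + a < k) (f : ℕ → ℤ) :
    signedRotate k (-a) f p = f (p + a) := by
  simp only [signedRotate]
  grind

theorem signedRotate_neg_natCast_of_ge {k a p : ℕ} (hp : k ≤ p + a) (hpk : p < k) (f : ℕ → ℤ) :
    signedRotate k (-a) f p = -f (p + a - k) := by
  simp only [signedRotate]
  grind

/-- The shape of a sequence obtained from `baseSeq` by signed rotations of initial blocks of
decreasing sizes, the last of which is at least `K`: negative entries precede the positive ones,
the first `K` entries are up to signs a rotation of an increasing sequence, and `D` records the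
positions of descents from `K` on. -/
structure RotationShape (D : ℕ → Prop) (S : ℤ) (K : ℕ) (f : ℕ → ℤ) : Prop where
  neg : ∀ p : ℕ, (p : ℤ) < S → f p < 0
  pos : ∀ p : ℕ, S ≤ p → 0 < f p
  decreasing : ∀ p q : ℕ, p < q → (q : ℤ) < S → f q < f p
  increasing : ∀ p q : ℕ, S ≤ p → p < q → q < K → f p < f q
  lt_neg : ∀ p q : ℕ, (p : ℤ) < S → S ≤ q → q < K → f q < -f p
  descent_iff : ∀ p : ℕ, K ≤ p → 0 < p → (f p < f (p - 1) ↔ D p)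
  le_of_descent : ∀ p : ℕ, D p → K ≤ p

theorem RotationShape.signedRotate {D : ℕ → Prop} {S : ℤ} {K : ℕ} {f : ℕ → ℤ}
    (h : RotationShape D S K f) {k : ℕ} {i : ℤ} (hk : 1 ≤ k) (hkK : k < K) (hS0 : 0 ≤ S)
    (hS : S ≤ k) (hi : -(k : ℤ) ≤ i) (hi' : i ≤ k - 1) (hi0 : i ≠ 0) (hS0' : 0 ≤ S + i)
    (hS' : S + i ≤ k) :
    RotationShape (fun p => D p ∨ (i < 0 ∧ k = p)) (S + i) k (signedRotate k i f) := by
  obtain ⟨h1, h2, h3, h4, h5, h6, h7⟩ := h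
  lift S to ℕ using hS0
  obtain ⟨a, rfl | rfl⟩ := i.eq_nat_or_neg
  · have g1 := fun p (hp : p < a) => signedRotate_natCast_of_lt hp (by omega : a ≤ k) f
    have g2 := fun p (hp : a ≤ p) (hpk : p < k) => signedRotate_natCast_of_ge hp hpk f
    have g3 := fun p (hp : k ≤ p) => signedRotate_of_le hp a f
    generalize _root_.signedRotate k a f = g at *
    constructor
    · intro p hp
      rcases lt_or_ge p a with hpa | hpa
      · rw [g1 p hpa]
        have := h2 (p + (k - a)) (by omega)
        omega
      · rw [g2 p hpa (by omega)]
        exact h1 _ (by omega)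
    · intro p hp
      rcases lt_or_ge p k with hpk | hpk
      · rw [g2 p (by omega) hpk]
        exact h2 _ (by omega)
      · rw [g3 p hpk]
        exact h2 _ (by omega)
    · intro p q hpq hq
      rcases lt_or_ge p a with hpa | hpa <;> rcases lt_or_ge q a with hqa | hqa
      · rw [g1 p hpa, g1 q hqa]
        have := h4 (p + (k - a)) (q + (k - a)) (by omega) (by omega) (by omega)
        omega
      · rw [g1 p hpa, g2 q hqa (by omega)]
        have := h5 (q - a) (p + (k - a)) (by omega) (by omega) (by omega)
        omega
      · omega
      · rw [g2 p hpa (by omega), g2 q hqa (by omega)]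
        exact h3 _ _ (by omega) (by omega)
    · intro p q hp hpq hq
      rw [g2 p (by omega) (by omega), g2 q (by omega) hq]
      exact h4 _ _ (by omega) (by omega) (by omega)
    · intro p q hp hq hqk
      rw [g2 q (by omega) hqk]
      rcases lt_or_ge p a with hpa | hpa
      · rw [g1 p hpa, neg_neg]
        exact h4 _ _ (by omega) (by omega) (by omega)
      · rw [g2 p hpa (by omega)]
        exact h5 _ _ (by omega) (by omega) (by omega)
    · intro p hp hp0
      rcases Nat.eq_or_lt_of_le hp with rfl | hp
      · have hD : ¬D k := fun h => by have := h7 k h; omega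
        have hpos := h2 k (by omega)
        have hlt : f (k - 1 - a) < f k := by
          by_cases hlast : S ≤ k - 1 - a
          · exact h4 _ _ (by omega) (by omega) hkK
          · exact (h1 _ (by omega)).trans hpos
        rw [g3 k le_rfl, g2 (k - 1) (by omega) (by omega)]
        simp only [hD, false_or]
        omega
      · rw [g3 p hp.le, g3 (p - 1) (by omega)]
        by_cases hpK : K ≤ p
        · rw [h6 p hpK hp0]
          simp only [hp.ne, and_false, or_false]
        · have hD : ¬D p := fun h => hpK (h7 p h)
          have := h4 (p - 1) p (by omega) (by omega) (by omega)
          simp only [hD, false_or]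
          omega
    · rintro p (hp | ⟨-, rfl⟩)
      · exact hkK.le.trans (h7 p hp)
      · exact le_rfl
  · have g1 := fun p (hp : p + a < k) => signedRotate_neg_natCast_of_lt hp f
    have g2 := fun p (hp : k ≤ p + a) (hpk : p < k) => signedRotate_neg_natCast_of_ge hp hpk f
    have g3 := fun p (hp : k ≤ p) => signedRotate_of_le hp (-a) f
    generalize _root_.signedRotate k (-a) f = g at *
    constructor
    · intro p hp
      rw [g1 p (by omega)]
      exact h1 _ (by omega)
    · intro p hp
      rcases lt_or_ge p k with hpk | hpk
      · rcases lt_or_ge (p + a) k with hpa | hpa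
        · rw [g1 p hpa]
          exact h2 _ (by omega)
        · rw [g2 p hpa hpk]
          have := h1 (p + a - k) (by omega)
          omega
      · rw [g3 p hpk]
        exact h2 _ (by omega)
    · intro p q hpq hq
      rw [g1 p (by omega), g1 q (by omega)]
      exact h3 _ _ (by omega) (by omega)
    · intro p q hp hpq hq
      rcases lt_or_ge (q + a) k with hqa | hqa
      · rw [g1 p (by omega), g1 q hqa]
        exact h4 _ _ (by omega) (by omega) (by omega)
      · rw [g2 q hqa hq]
        rcases lt_or_ge (p + a) k with hpa | hpa
        · rw [g1 p hpa]
          exact h5 _ _ (by omega) (by omega) (by omega)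
        · rw [g2 p hpa (by omega)]
          have := h3 (p + a - k) (q + a - k) (by omega) (by omega)
          omega
    · intro p q hp hq hqk
      rw [g1 p (by omega)]
      rcases lt_or_ge (q + a) k with hqa | hqa
      · rw [g1 q hqa]
        exact h5 _ _ (by omega) (by omega) (by omega)
      · rw [g2 q hqa hqk]
        have := h3 (q + a - k) (p + a) (by omega) (by omega)
        omega
    · intro p hp hp0
      rcases Nat.eq_or_lt_of_le hp with rfl | hp
      · have hlt := h5 (k - 1 + a - k) k (by omega) (by omega) hkK
        rw [g3 k le_rfl, g2 (k - 1) (by omega) (by omega)]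
        exact iff_of_true hlt (Or.inr ⟨by omega, rfl⟩)
      · rw [g3 p hp.le, g3 (p - 1) (by omega)]
        by_cases hpK : K ≤ p
        · rw [h6 p hpK hp0]
          simp only [hp.ne, and_false, or_false]
        · have hD : ¬D p := fun h => hpK (h7 p h)
          have := h4 (p - 1) p (by omega) (by omega) (by omega)
          simp only [hD, hp.ne, and_false, or_false, iff_false]
          omega
    · rintro p (hp | ⟨-, rfl⟩)
      · exact hkK.le.trans (h7 p hp)
      · exact le_rfl

theorem rotationShape_baseSeq (K : ℕ) : RotationShape (fun _ => False) 0 K baseSeq := by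
  constructor <;> grind [baseSeq]

/-- The sum of the exponents from position `r` on. -/
def tailSum {m : ℕ} (i : Fin m → ℤ) (r : ℕ) : ℤ :=
  ∑ j ∈ Finset.univ.filter (fun j : Fin m => r ≤ (j : ℕ)), i j

theorem tailSum_of_le {m : ℕ} (i : Fin m → ℤ) {r : ℕ} (hr : m ≤ r) : tailSum i r = 0 := by
  rw [tailSum, Finset.filter_false_of_mem, Finset.sum_empty]
  intro j _
  omega

theorem tailSum_succ {m : ℕ} (i : Fin m → ℤ) {r : ℕ} (hr : r < m) :
    tailSum i r = tailSum i (r + 1) + i ⟨r, hr⟩ := by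
  have : Finset.univ.filter (fun j : Fin m => r ≤ (j : ℕ)) =
      insert ⟨r, hr⟩ (Finset.univ.filter (fun j : Fin m => r + 1 ≤ (j : ℕ))) := by
    ext j
    simp only [Finset.mem_filter, Finset.mem_univ, true_and, Finset.mem_insert, Fin.ext_iff]
    omega
  rw [tailSum, this, Finset.sum_insert (by simp), tailSum, add_comm]

namespace IsAdmissible

variable {cs : CoxeterSystem (BCoxeterMatrix n) W} {w : W} {m : ℕ} {k : Fin m → ℕ} {i : Fin m → ℤ}

theorem tailSum_zero (h : IsAdmissible cs w m k i) : tailSum i 0 = 0 := by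
  simpa [tailSum] using h.total

theorem tailSum_nonneg (h : IsAdmissible cs w m k i) (r : ℕ) : 0 ≤ tailSum i r := by
  rcases Nat.eq_zero_or_pos r with rfl | hr
  · exact h.tailSum_zero.ge
  · by_cases hm : r < m
    · exact (h.partialSum r hr hm).1
    · exact (tailSum_of_le i (by omega)).ge

theorem tailSum_succ_le (h : IsAdmissible cs w m k i) {r : ℕ} (hr : r < m) :
    tailSum i (r + 1) ≤ k ⟨r, hr⟩ := by
  by_cases hm : r + 1 < m
  · exact (h.partialSum (r + 1) (by omega) hm).2
  · rw [tailSum_of_le i (by omega)]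
    positivity

theorem tailSum_le (h : IsAdmissible cs w m k i) {r : ℕ} (hr : r < m) :
    tailSum i r ≤ k ⟨r, hr⟩ := by
  cases r with
  | zero => rw [h.tailSum_zero]; positivity
  | succ r =>
    have h1 := h.tailSum_succ_le (r := r) (by omega)
    have h2 : k ⟨r, by omega⟩ < k ⟨r + 1, hr⟩ := h.mono (by simp)
    omega

theorem lt_of_neg (h : IsAdmissible cs w m k i) (j : Fin m) (hj : i j < 0) : k j < n := by
  have h0 := h.tailSum_nonneg j
  rw [tailSum_succ i j.2] at h0
  have hm : (j : ℕ) + 1 < m := by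
    by_contra hm
    rw [tailSum_of_le i (by omega)] at h0
    simp only [Fin.eta] at h0
    omega
  have h1 : k j < k ⟨j + 1, hm⟩ := h.mono (by simp [Fin.lt_def])
  exact h1.trans_le (h.le_n _)

theorem rotationShape_drop (h : IsAdmissible cs w m k i) {r : ℕ} (hr : r ≤ m) :
    RotationShape (fun p => ∃ j : Fin m, r ≤ (j : ℕ) ∧ i j < 0 ∧ k j = p) (tailSum i r)
      (if hm : r < m then k ⟨r, hm⟩ else n + 1)
      (seqAction cs (((List.finRange m).drop r).map (fun j => tau cs (k j) ^ i j)).prod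
        baseSeq) := by
  induction hr using Nat.decreasingInduction with
  | self =>
    rw [tailSum_of_le i le_rfl, dif_neg (lt_irrefl m), List.drop_eq_nil_of_le (by simp)]
    convert rotationShape_baseSeq (n + 1) using 1
    · funext p
      simp only [eq_iff_iff, iff_false, not_exists, not_and]
      intro j hj
      omega
    · simp
  | of_succ r hr ih =>
    have hlt : k ⟨r, hr⟩ < (if hm : r + 1 < m then k ⟨r + 1, hm⟩ else n + 1) := by
      split_ifs with hm
      · exact h.mono (by simp)
      · exact Nat.lt_succ_of_le (h.le_n _)
    have hub := h.ub ⟨r, hr⟩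
    have hle := h.tailSum_le hr
    have h0 := h.tailSum_nonneg r
    rw [tailSum_succ i hr] at hle h0
    have := ih.signedRotate (h.one_le ⟨r, hr⟩) hlt (h.tailSum_nonneg _) (h.tailSum_succ_le hr)
      (h.lb ⟨r, hr⟩) hub (h.ne_zero _) h0 hle
    rw [tailSum_succ i hr, dif_pos hr, List.drop_eq_getElem_cons (by simpa using hr),
      List.map_cons, List.prod_cons, map_mul, Equiv.Perm.mul_apply, List.getElem_finRange]
    simp only [Fin.cast_mk]
    rw [seqAction_tau_zpow cs (h.le_n _) (h.lb _) (by omega)]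
    convert this using 1
    funext p
    simp only [eq_iff_iff]
    constructor
    · rintro ⟨j, hj, hneg, hp⟩
      rcases Nat.eq_or_lt_of_le hj with rfl | hj
      · exact Or.inr ⟨hneg, hp⟩
      · exact Or.inl ⟨j, hj, hneg, hp⟩
    · rintro (⟨j, hj, hneg, hp⟩ | ⟨hneg, hp⟩)
      · exact ⟨j, by omega, hneg, hp⟩
      · exact ⟨⟨r, hr⟩, le_rfl, hneg, hp⟩

/-- The left descents of an element with an admissible presentation are the indices `k_j` of the
factors with a negative exponent. -/
theorem isLeftDescent_iff (h : IsAdmissible cs w m k i) (s : Fin n) :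
    cs.IsLeftDescent w s ↔ ∃ j : Fin m, i j < 0 ∧ k j = s := by
  have hshape := h.rotationShape_drop (Nat.zero_le m)
  rw [List.drop_zero, ← h.prod_eq, h.tailSum_zero] at hshape
  simp only [Nat.zero_le, true_and] at hshape
  rw [isLeftDescent_iff_rootPairing_neg]
  obtain ⟨-, hpos, -, hinc, -, hdesc, hD⟩ := hshape
  have hone := h.one_le
  generalize seqAction cs w baseSeq = f at *
  generalize (if hm : 0 < m then k ⟨0, hm⟩ else n + 1) = K at *
  rw [rootPairing]
  split_ifs with hs
  · have := hpos 0 (by simp)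
    constructor
    · intro; omega
    · rintro ⟨j, -, hj⟩
      have := hone j
      omega
  · by_cases hK : K ≤ s
    · rw [← hdesc s hK (by omega)]
      omega
    · have := hinc (s - 1) s (by omega) (by omega) (by omega)
      constructor
      · intro; omega
      · intro hj
        exact absurd (hD s hj) hK

end IsAdmissible

/-- If `w` has an `Ṡ_n`-admissible presentation `w = τ_{k_1}^{i_{k_1}} ⋯ τ_{k_m}^{i_{k_m}}`,
then the number of left descents of `w` equals the number of indices `j` with
`i_{k_j} < 0`. -/
theorem card_descents_eq (cs : CoxeterSystem (BCoxeterMatrix n) W) (w : W)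
    (m : ℕ) (k : Fin m → ℕ) (i : Fin m → ℤ) (h : IsAdmissible cs w m k i) :
    Nat.card {j : Fin n // cs.IsLeftDescent w j} = Nat.card {j : Fin m // i j < 0} := by
  symm
  refine Nat.card_eq_of_bijective
    (fun j => ⟨⟨k j.1, h.lt_of_neg j.1 j.2⟩, (h.isLeftDescent_iff _).2 ⟨j.1, j.2, rfl⟩⟩) ⟨?_, ?_⟩
  · intro a b hab
    simp only [Subtype.mk.injEq, Fin.mk.injEq] at hab
    exact Subtype.ext (h.mono.injective hab)
  · rintro ⟨s, hs⟩
    obtain ⟨j, hj, hk⟩ := (h.isLeftDescent_iff s).1 hs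
    exact ⟨⟨j, hj⟩, Subtype.ext (Fin.ext hk)⟩
end

section
/- Let 1 ≤ q ≤ n, let w ∈ W belong to the parabolic subgroup of W generated by {s_0, s_1, …, s_{q−1}}, and let u ∈ W have an Ṡ_n-admissible presentation u = τ_{k_1}^{i_{k_1}}·τ_{k_2}^{i_{k_2}}⋯τ_{k_m}^{i_{k_m}} with k_1 ≥ q. Then ℓ(w·u) = ℓ(w) + ℓ(u). -/
variable {n : ℕ} {W : Type*} [Group W]

/-- The action of the `j`-th simple reflection of type `B` on `ℤ`, where `x ≥ 0` stands for the
basis vector `e_{x+1}` and `-1 - x` for its negative. -/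
def simpleFlip (j : ℕ) (x : ℤ) : ℤ :=
  if x = (j : ℤ) - 1 then (j : ℤ) else if x = (j : ℤ) then (j : ℤ) - 1
    else if x = -(j : ℤ) then -1 - (j : ℤ) else if x = -1 - (j : ℤ) then -(j : ℤ) else x

section simpleFlip

variable {j : ℕ} {x : ℤ}

lemma simpleFlip_of_eq_sub_one (h : x = (j : ℤ) - 1) : simpleFlip j x = j := by
  simp [simpleFlip, h]

lemma simpleFlip_of_eq (h : x = j) : simpleFlip j x = (j : ℤ) - 1 := by
  simp [simpleFlip, h]

lemma simpleFlip_of_eq_neg (h : x = -(j : ℤ)) : simpleFlip j x = -1 - (j : ℤ) := by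
  unfold simpleFlip
  split_ifs <;> omega

lemma simpleFlip_of_eq_neg_one_sub (h : x = -1 - (j : ℤ)) : simpleFlip j x = -(j : ℤ) := by
  unfold simpleFlip
  split_ifs <;> omega

lemma simpleFlip_of_ne (h₁ : x ≠ (j : ℤ) - 1) (h₂ : x ≠ j) (h₃ : x ≠ -(j : ℤ))
    (h₄ : x ≠ -1 - (j : ℤ)) : simpleFlip j x = x := by
  simp [simpleFlip, h₁, h₂, h₃, h₄]

end simpleFlip

lemma simpleFlip_involutive (j : ℕ) : Function.Involutive (simpleFlip j) := by
  intro x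
  by_cases h₁ : x = (j : ℤ) - 1
  · rw [simpleFlip_of_eq_sub_one h₁, simpleFlip_of_eq rfl, h₁]
  by_cases h₂ : x = j
  · rw [simpleFlip_of_eq h₂, simpleFlip_of_eq_sub_one rfl, h₂]
  by_cases h₃ : x = -(j : ℤ)
  · rw [simpleFlip_of_eq_neg h₃, simpleFlip_of_eq_neg_one_sub rfl, h₃]
  by_cases h₄ : x = -1 - (j : ℤ)
  · rw [simpleFlip_of_eq_neg_one_sub h₄, simpleFlip_of_eq_neg rfl, h₄]
  rw [simpleFlip_of_ne h₁ h₂ h₃ h₄, simpleFlip_of_ne h₁ h₂ h₃ h₄]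

lemma simpleFlip_neg_one_sub (j : ℕ) (x : ℤ) :
    simpleFlip j (-1 - x) = -1 - simpleFlip j x := by
  unfold simpleFlip
  split_ifs <;> omega

/-- A simple reflection reverses the order of only one pair, up to the sign symmetry. -/
lemma eq_or_eq_of_simpleFlip_lt {j : ℕ} {x y : ℤ} (h : x < y)
    (h' : simpleFlip j y < simpleFlip j x) :
    (x = (j : ℤ) - 1 ∧ y = j) ∨ (x = -1 - (j : ℤ) ∧ y = -(j : ℤ)) := by
  unfold simpleFlip at h'
  split_ifs at h' <;> omega

lemma simpleFlip_comm {i j : ℕ} (h : i + 2 ≤ j) (x : ℤ) :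
    simpleFlip i (simpleFlip j x) = simpleFlip j (simpleFlip i x) := by
  by_cases h₁ : x = (j : ℤ) - 1 ∨ x = j ∨ x = -(j : ℤ) ∨ x = -1 - (j : ℤ)
  · rw [simpleFlip_of_ne (j := i) (x := x) (by omega) (by omega) (by omega) (by omega)]
    unfold simpleFlip
    split_ifs <;> omega
  · rw [simpleFlip_of_ne (j := j) (x := x) (by omega) (by omega) (by omega) (by omega)]
    unfold simpleFlip
    split_ifs <;> omega

lemma simpleFlip_braid {i : ℕ} (h : 1 ≤ i) (x : ℤ) :
    simpleFlip i (simpleFlip (i + 1) (simpleFlip i x)) =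
      simpleFlip (i + 1) (simpleFlip i (simpleFlip (i + 1) x)) := by
  by_cases h₁ : x = (i : ℤ) - 1 ∨ x = i ∨ x = i + 1 ∨ x = -(i : ℤ) ∨ x = -1 - (i : ℤ) ∨
    x = -2 - (i : ℤ)
  · rcases h₁ with h₁ | h₁ | h₁ | h₁ | h₁ | h₁ <;>
    simp (disch := (push_cast; omega)) only [simpleFlip_of_eq_sub_one, simpleFlip_of_eq,
      simpleFlip_of_eq_neg, simpleFlip_of_eq_neg_one_sub, simpleFlip_of_ne] <;> push_cast <;> omega
  · simp (disch := (push_cast; omega)) only [simpleFlip_of_ne]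

lemma simpleFlip_braid_zero (x : ℤ) :
    simpleFlip 0 (simpleFlip 1 (simpleFlip 0 (simpleFlip 1 x))) =
      simpleFlip 1 (simpleFlip 0 (simpleFlip 1 (simpleFlip 0 x))) := by
  by_cases h : x = 0 ∨ x = 1 ∨ x = -1 ∨ x = -2
  · rcases h with rfl | rfl | rfl | rfl <;> decide
  · simp (disch := (push_cast; omega)) only [simpleFlip_of_ne]

/-- `simpleFlip` as a permutation. -/
def simpleFlipPerm (j : ℕ) : Equiv.Perm ℤ := (simpleFlip_involutive j).toPerm

@[simp]
lemma simpleFlipPerm_apply (j : ℕ) (x : ℤ) : simpleFlipPerm j x = simpleFlip j x := rfl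

lemma simpleFlipPerm_mul_self (j : ℕ) : simpleFlipPerm j * simpleFlipPerm j = 1 :=
  Equiv.ext (simpleFlip_involutive j)

lemma simpleFlipPerm_inv (j : ℕ) : (simpleFlipPerm j)⁻¹ = simpleFlipPerm j :=
  inv_eq_of_mul_eq_one_left (simpleFlipPerm_mul_self j)

lemma isLiftable_simpleFlipPerm (n : ℕ) :
    (BCoxeterMatrix n).IsLiftable fun i : Fin n ↦ simpleFlipPerm i := by
  have symm {a b : Equiv.Perm ℤ} {r : ℕ} (h : (a * b) ^ r = 1) (ha : a⁻¹ = a) (hb : b⁻¹ = b) :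
      (b * a) ^ r = 1 := by
    rw [← inv_inj, ← inv_pow, mul_inv_rev, ha, hb, h, inv_one]
  have four : (simpleFlipPerm 0 * simpleFlipPerm 1) ^ 4 = 1 := by
    ext x
    have h := simpleFlip_braid_zero (simpleFlip 0 (simpleFlip 1 (simpleFlip 0 (simpleFlip 1 x))))
    simp only [pow_succ, pow_zero, one_mul, Equiv.Perm.mul_apply, simpleFlipPerm_apply, h,
      simpleFlip_involutive _ _, Equiv.Perm.one_apply]
  have three (i : ℕ) (hi : 1 ≤ i) : (simpleFlipPerm i * simpleFlipPerm (i + 1)) ^ 3 = 1 := by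
    ext x
    simp only [pow_succ, pow_zero, one_mul, Equiv.Perm.mul_apply, simpleFlipPerm_apply,
      simpleFlip_braid hi, simpleFlip_involutive _ _, Equiv.Perm.one_apply]
  have two (i j : ℕ) (hij : i + 2 ≤ j) : (simpleFlipPerm i * simpleFlipPerm j) ^ 2 = 1 := by
    ext x
    simp only [pow_succ, pow_zero, one_mul, Equiv.Perm.mul_apply, simpleFlipPerm_apply,
      simpleFlip_comm hij, simpleFlip_involutive _ _, Equiv.Perm.one_apply]
  rintro ⟨i, hi⟩ ⟨j, hj⟩
  simp only [BCoxeterMatrix, Matrix.of_apply, Fin.mk.injEq]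
  split_ifs with h₁ h₂ h₃
  · subst h₁
    rw [pow_one, simpleFlipPerm_mul_self]
  · rcases h₂ with ⟨rfl, rfl⟩ | ⟨rfl, rfl⟩
    · exact four
    · exact symm four (simpleFlipPerm_inv 0) (simpleFlipPerm_inv 1)
  · rcases h₃ with rfl | rfl
    · exact symm (three j (by omega)) (simpleFlipPerm_inv _) (simpleFlipPerm_inv _)
    · exact three i (by omega)
  · rcases lt_or_ge i j with h | h
    · exact two i j (by omega)
    · exact symm (two j i (by omega)) (simpleFlipPerm_inv _) (simpleFlipPerm_inv _)

namespace CoxeterB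

variable (cs : CoxeterSystem (BCoxeterMatrix n) W)

/-- The action of the Coxeter group of type `B` on `ℤ` by signed permutations. -/
def signedPerm : W →* Equiv.Perm ℤ := cs.lift ⟨_, isLiftable_simpleFlipPerm n⟩

lemma signedPerm_simple (j : Fin n) : signedPerm cs (cs.simple j) = simpleFlipPerm j :=
  cs.lift_apply_simple (isLiftable_simpleFlipPerm n) j

lemma signedPerm_sgen {j : ℕ} (h : j < n) : signedPerm cs (sgen cs j) = simpleFlipPerm j := by
  rw [sgen, dif_pos h, signedPerm_simple]

lemma signedPerm_neg_one_sub (w : W) (x : ℤ) :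
    signedPerm cs w (-1 - x) = -1 - signedPerm cs w x := by
  induction w using cs.simple_induction_left with
  | one => simp
  | mul_simple_left w i ih =>
    rw [map_mul, signedPerm_simple, Equiv.Perm.mul_apply, ih, Equiv.Perm.mul_apply,
      simpleFlipPerm_apply, simpleFlip_neg_one_sub, simpleFlipPerm_apply]

lemma sgen_mul_self (j : ℕ) : sgen cs j * sgen cs j = 1 := by
  unfold sgen
  split_ifs <;> simp

lemma sgen_inv (j : ℕ) : (sgen cs j)⁻¹ = sgen cs j :=
  inv_eq_of_mul_eq_one_left (sgen_mul_self cs j)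

lemma sgen_comm {i j : ℕ} (h : i + 2 ≤ j) : sgen cs i * sgen cs j = sgen cs j * sgen cs i := by
  by_cases hj : j < n
  · have hi : i < n := by omega
    have hM : (BCoxeterMatrix n) ⟨i, hi⟩ ⟨j, hj⟩ = 2 := by
      change Matrix.of _ _ _ = 2
      simp only [Matrix.of_apply, Fin.mk.injEq]
      split_ifs <;> omega
    have h2 := cs.simple_mul_simple_pow ⟨i, hi⟩ ⟨j, hj⟩
    rw [hM, pow_two, mul_eq_one_iff_eq_inv, mul_inv_rev, cs.inv_simple, cs.inv_simple] at h2
    simpa [sgen, hi, hj] using h2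
  · simp [sgen, hj]

lemma sgen_braid {i : ℕ} (hi : 1 ≤ i) (h : i + 1 < n) :
    sgen cs i * sgen cs (i + 1) * sgen cs i = sgen cs (i + 1) * sgen cs i * sgen cs (i + 1) := by
  have hM : (BCoxeterMatrix n) ⟨i, by omega⟩ ⟨i + 1, h⟩ = 3 := by
    change Matrix.of _ _ _ = 3
    simp only [Matrix.of_apply, Fin.mk.injEq]
    rw [if_neg (by omega), if_neg (by omega), if_pos (by simp)]
  have h3 := cs.simple_mul_simple_pow ⟨i, by omega⟩ ⟨i + 1, h⟩
  rw [hM, pow_succ, pow_two] at h3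
  have h4 := eq_inv_of_mul_eq_one_left
    (show cs.simple ⟨i, by omega⟩ * cs.simple ⟨i + 1, h⟩ * cs.simple ⟨i, by omega⟩ *
      (cs.simple ⟨i + 1, h⟩ * cs.simple ⟨i, by omega⟩ * cs.simple ⟨i + 1, h⟩) = 1 by
        simpa only [mul_assoc] using h3)
  simpa [sgen, h, show i < n by omega, mul_assoc] using h4

lemma sgen_braid_zero (h : 1 < n) :
    sgen cs 1 * sgen cs 0 * sgen cs 1 * sgen cs 0 * sgen cs 1 * sgen cs 0 * sgen cs 1 =
      sgen cs 0 := by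
  have hM : (BCoxeterMatrix n) ⟨0, by omega⟩ ⟨1, h⟩ = 4 := by
    change Matrix.of _ _ _ = 4
    simp
  have h4 := cs.simple_mul_simple_pow ⟨0, by omega⟩ ⟨1, h⟩
  rw [hM] at h4
  simp only [pow_succ, pow_zero, one_mul, mul_assoc] at h4
  rw [mul_eq_one_iff_inv_eq, cs.inv_simple] at h4
  simpa [sgen, h, show 0 < n by omega, mul_assoc] using h4.symm

/-- The parabolic subgroup generated by `s_0, …, s_{k-1}`. -/
def parabolic (k : ℕ) : Subgroup W := Subgroup.closure (sgen cs '' {j | j < k})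

lemma sgen_mem_parabolic {j k : ℕ} (h : j < k) : sgen cs j ∈ parabolic cs k :=
  Subgroup.subset_closure ⟨j, h, rfl⟩

lemma parabolic_top : parabolic cs n = ⊤ := by
  rw [← cs.subgroup_closure_range_simple, parabolic]
  congr 1
  ext w
  constructor
  · rintro ⟨j, hj : j < n, rfl⟩
    exact ⟨⟨j, hj⟩, by simp [sgen, hj]⟩
  · rintro ⟨j, rfl⟩
    exact ⟨j, j.2, by simp [sgen]⟩

/-- The right coset representatives `1, s_k, s_k s_{k-1}, …, s_k ⋯ s_1 s_0 s_1 ⋯ s_k` of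
`parabolic cs k` in `parabolic cs (k + 1)`. -/
def cosetRep (k : ℕ) : ℕ → W
  | 0 => 1
  | d + 1 => cosetRep k d * sgen cs (Int.natAbs ((k : ℤ) - d))

lemma cosetRep_succ (k d j : ℕ) (h : ((k : ℤ) - d).natAbs = j) :
    cosetRep cs k (d + 1) = cosetRep cs k d * sgen cs j := by
  rw [cosetRep, h]

lemma signedPerm_cosetRep {k : ℕ} (hk : k < n) (d : ℕ) (hd : d ≤ 2 * k + 1) :
    signedPerm cs (cosetRep cs k d) ((k : ℤ) - d) = k := by
  induction d with
  | zero => simp [cosetRep]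
  | succ d ih =>
    rw [cosetRep, map_mul, signedPerm_sgen cs (by omega), Equiv.Perm.mul_apply,
      simpleFlipPerm_apply]
    convert ih (by omega) using 2
    rcases le_or_gt 0 ((k : ℤ) - d) with h | h
    · rw [simpleFlip_of_eq_sub_one] <;> omega
    · rw [simpleFlip_of_eq_neg_one_sub] <;> omega

lemma conj_cosetRep_mem {k : ℕ} (hk : k < n) {d : ℕ} (hd : d ≤ 2 * k + 1) {j : ℕ} (hj : j ≤ k)
    (h₁ : (k : ℤ) - d ≠ j - 1) (h₂ : (k : ℤ) - d ≠ j) (h₃ : (k : ℤ) - d ≠ -j)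
    (h₄ : (k : ℤ) - d ≠ -1 - j) :
    cosetRep cs k d * sgen cs j * (cosetRep cs k d)⁻¹ ∈ parabolic cs k := by
  induction d using Nat.strong_induction_on generalizing j with
  | _ d ih =>
    obtain _ | d := d
    · simpa [cosetRep] using sgen_mem_parabolic cs (show j < k by omega)
    push_cast at h₁ h₂ h₃ h₄
    obtain ⟨i, hi⟩ : ∃ i, ((k : ℤ) - d).natAbs = i := ⟨_, rfl⟩
    rw [cosetRep_succ cs k d i hi, mul_inv_rev, sgen_inv]
    by_cases hij : i + 2 ≤ j ∨ j + 2 ≤ i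
    · have hcomm : sgen cs i * sgen cs j = sgen cs j * sgen cs i :=
        hij.elim (sgen_comm cs) fun h ↦ (sgen_comm cs h).symm
      have := ih d (by omega) (by omega) hj (by omega) (by omega) (by omega) (by omega)
      convert this using 1
      calc _ = cosetRep cs k d * (sgen cs i * sgen cs j) * sgen cs i * (cosetRep cs k d)⁻¹ := by
            simp only [mul_assoc]
        _ = cosetRep cs k d * sgen cs j * (sgen cs i * sgen cs i) * (cosetRep cs k d)⁻¹ := by
            rw [hcomm]; simp only [mul_assoc]
        _ = _ := by rw [sgen_mul_self, mul_one]
    obtain _ | d := d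
    · omega
    by_cases hj0 : j = 0
    · obtain _ | d := d
      · omega
      have hd1 : (k : ℤ) - d = 1 := by omega
      have hi1 : i = 1 := by omega
      have := ih d (by omega) (by omega) hj (by omega) (by omega) (by omega) (by omega)
      subst hj0 hi1
      convert this using 1
      rw [cosetRep_succ cs k (d + 1) 0 (by omega), cosetRep_succ cs k d 1 (by omega)]
      nth_rw 4 [← sgen_braid_zero cs (by omega)]
      simp only [mul_inv_rev, sgen_inv, mul_assoc]
    have hbraid : sgen cs j * sgen cs i * sgen cs j = sgen cs i * sgen cs j * sgen cs i := by
      obtain rfl | rfl : i = j + 1 ∨ j = i + 1 := by omega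
      · exact sgen_braid cs (by omega) (by omega)
      · exact (sgen_braid cs (by omega) (by omega)).symm
    have := ih d (by omega) (by omega) (show i ≤ k by omega) (by omega) (by omega) (by omega)
      (by omega)
    convert this using 1
    rw [cosetRep_succ cs k d j (by omega), mul_inv_rev, sgen_inv]
    calc _ = cosetRep cs k d * (sgen cs j * (sgen cs i * sgen cs j * sgen cs i) * sgen cs j) *
          (cosetRep cs k d)⁻¹ := by simp only [mul_assoc]
      _ = cosetRep cs k d * ((sgen cs j * sgen cs j) * sgen cs i * (sgen cs j * sgen cs j)) *
          (cosetRep cs k d)⁻¹ := by rw [← hbraid]; simp only [mul_assoc]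
      _ = _ := by rw [sgen_mul_self, one_mul, mul_one]

lemma exists_eq_mul_cosetRep {k : ℕ} (hk : k < n) {w : W} (hw : w ∈ parabolic cs (k + 1)) :
    ∃ d ≤ 2 * k + 1, ∃ v ∈ parabolic cs k, w = v * cosetRep cs k d := by
  have step (d j : ℕ) (hd : d ≤ 2 * k + 1) (hj : j ≤ k) (v : W) (hv : v ∈ parabolic cs k) :
      ∃ d' ≤ 2 * k + 1, ∃ v' ∈ parabolic cs k,
        v * cosetRep cs k d * sgen cs j = v' * cosetRep cs k d' := by
    by_cases h : (k : ℤ) - d = j ∨ (k : ℤ) - d = -j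
    · exact ⟨d + 1, by omega, v, hv, by rw [cosetRep_succ cs k d j (by omega), mul_assoc]⟩
    by_cases h' : (k : ℤ) - d = j - 1 ∨ (k : ℤ) - d = -1 - j
    · obtain _ | d := d
      · omega
      exact ⟨d, by omega, v, hv, by
        rw [cosetRep_succ cs k d j (by omega), mul_assoc, mul_assoc, sgen_mul_self, mul_one]⟩
    · exact ⟨d, hd, _, mul_mem hv (conj_cosetRep_mem cs hk hd hj (by omega) (by omega) (by omega)
        (by omega)), by group⟩
  induction hw using Subgroup.closure_induction_right with
  | one => exact ⟨0, by omega, 1, one_mem _, by simp [cosetRep]⟩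
  | mul_right x hx y hy ih =>
    obtain ⟨d, hd, v, hv, rfl⟩ := ih
    obtain ⟨j, hj, rfl⟩ := hy
    exact step d j hd (Nat.lt_succ_iff.mp hj) v hv
  | mul_inv_cancel x hx y hy ih =>
    obtain ⟨d, hd, v, hv, rfl⟩ := ih
    obtain ⟨j, hj, rfl⟩ := hy
    rw [sgen_inv]
    exact step d j hd (Nat.lt_succ_iff.mp hj) v hv

lemma signedPerm_parabolic_apply {k : ℕ} (hk : k < n) {w : W} (hw : w ∈ parabolic cs k) :
    signedPerm cs w k = k := by
  suffices parabolic cs k ≤ (MulAction.stabilizer (Equiv.Perm ℤ) (k : ℤ)).comap (signedPerm cs) from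
    this hw
  rw [parabolic, Subgroup.closure_le]
  rintro _ ⟨j, hj : j < k, rfl⟩
  change signedPerm cs (sgen cs j) k = k
  rw [signedPerm_sgen cs (by omega), simpleFlipPerm_apply, simpleFlip_of_ne] <;> omega

lemma eq_one_of_signedPerm_eq_one {k : ℕ} (hk : k ≤ n) {w : W} (hw : w ∈ parabolic cs k)
    (h : signedPerm cs w = 1) : w = 1 := by
  induction k generalizing w with
  | zero => simpa [parabolic] using hw
  | succ k ih =>
    obtain ⟨d, hd, v, hv, rfl⟩ := exists_eq_mul_cosetRep cs hk hw
    have h' := Equiv.congr_fun h ((k : ℤ) - d)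
    rw [map_mul, Equiv.Perm.mul_apply, signedPerm_cosetRep cs hk d hd,
      signedPerm_parabolic_apply cs hk hv, Equiv.Perm.one_apply] at h'
    obtain rfl : d = 0 := by omega
    simp only [cosetRep, mul_one] at h ⊢
    exact ih (by omega) hv h

lemma signedPerm_injective : Function.Injective (signedPerm cs) :=
  (injective_iff_map_eq_one _).2 fun _ h ↦
    eq_one_of_signedPerm_eq_one cs le_rfl (by simp [parabolic_top]) h

lemma simple_mul_eq_mul_simple {w : W} {i j : Fin n}
    (h : signedPerm cs w ((j : ℤ) - 1) < signedPerm cs w j)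
    (h' : simpleFlip i (signedPerm cs w j) < simpleFlip i (signedPerm cs w ((j : ℤ) - 1))) :
    cs.simple i * w = w * cs.simple j := by
  apply signedPerm_injective cs
  ext y
  simp only [map_mul, signedPerm_simple, Equiv.Perm.mul_apply, simpleFlipPerm_apply]
  have hpair := eq_or_eq_of_simpleFlip_lt h h'
  have hneg₁ := signedPerm_neg_one_sub cs w ((j : ℤ) - 1)
  have hneg₂ := signedPerm_neg_one_sub cs w j
  rw [show -1 - ((j : ℤ) - 1) = -j by ring] at hneg₁
  by_cases h₁ : y = (j : ℤ) - 1
  · rw [simpleFlip_of_eq_sub_one h₁, h₁]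
    unfold simpleFlip
    split_ifs <;> omega
  by_cases h₂ : y = j
  · rw [simpleFlip_of_eq h₂, h₂]
    unfold simpleFlip
    split_ifs <;> omega
  by_cases h₃ : y = -(j : ℤ)
  · rw [simpleFlip_of_eq_neg h₃, h₃]
    unfold simpleFlip
    split_ifs <;> omega
  by_cases h₄ : y = -1 - (j : ℤ)
  · rw [simpleFlip_of_eq_neg_one_sub h₄, h₄]
    unfold simpleFlip
    split_ifs <;> omega
  have k₁ := (signedPerm cs w).injective.ne h₁
  have k₂ := (signedPerm cs w).injective.ne h₂
  have k₃ := (signedPerm cs w).injective.ne h₃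
  have k₄ := (signedPerm cs w).injective.ne h₄
  rw [simpleFlip_of_ne h₁ h₂ h₃ h₄, simpleFlip_of_ne] <;> omega

/-- The exchange property: a word sending the simple root of `j` to a negative root can be
shortened after multiplication by `s_j`. -/
lemma exists_wordProd_eq_mul_simple (ω : List (Fin n)) (j : Fin n)
    (h : signedPerm cs (cs.wordProd ω) j < signedPerm cs (cs.wordProd ω) ((j : ℤ) - 1)) :
    ∃ ω' : List (Fin n), ω'.length < ω.length ∧ cs.wordProd ω' = cs.wordProd ω * cs.simple j := by
  induction ω with
  | nil =>
    simp only [CoxeterSystem.wordProd_nil, map_one, Equiv.Perm.one_apply] at h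
    omega
  | cons i ω ih =>
    by_cases h' : signedPerm cs (cs.wordProd ω) j < signedPerm cs (cs.wordProd ω) ((j : ℤ) - 1)
    · obtain ⟨ω', hlen, hprod⟩ := ih h'
      exact ⟨i :: ω', by simpa using hlen, by
        rw [cs.wordProd_cons, cs.wordProd_cons, hprod, mul_assoc]⟩
    · refine ⟨ω, by simp, ?_⟩
      have hne : signedPerm cs (cs.wordProd ω) j ≠ signedPerm cs (cs.wordProd ω) ((j : ℤ) - 1) :=
        (signedPerm cs _).injective.ne (by omega)
      rw [cs.wordProd_cons, map_mul, signedPerm_simple] at h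
      rw [cs.wordProd_cons, simple_mul_eq_mul_simple cs (by omega) h,
        cs.simple_mul_simple_cancel_right]

lemma isRightDescent_iff_lt (w : W) (j : Fin n) :
    cs.IsRightDescent w j ↔ signedPerm cs w j < signedPerm cs w ((j : ℤ) - 1) := by
  have key (w : W) (h : signedPerm cs w j < signedPerm cs w ((j : ℤ) - 1)) :
      cs.length (w * cs.simple j) < cs.length w := by
    obtain ⟨ω, hω, rfl⟩ := cs.exists_isReduced w
    obtain ⟨ω', hlen, hprod⟩ := exists_wordProd_eq_mul_simple cs ω j h
    rw [← hprod, hω.eq]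
    exact (cs.length_wordProd_le ω').trans_lt hlen
  refine ⟨fun h ↦ ?_, key w⟩
  by_contra h'
  have hne : signedPerm cs w j ≠ signedPerm cs w ((j : ℤ) - 1) :=
    (signedPerm cs _).injective.ne (by omega)
  have := key (w * cs.simple j) (by
    rw [map_mul, signedPerm_simple, Equiv.Perm.mul_apply, Equiv.Perm.mul_apply,
      simpleFlipPerm_apply, simpleFlipPerm_apply, simpleFlip_of_eq rfl,
      simpleFlip_of_eq_sub_one rfl]
    omega)
  rw [cs.simple_mul_simple_cancel_right] at this
  exact absurd h (not_lt.2 this.le)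

lemma isLeftDescent_iff_lt (w : W) (j : Fin n) :
    cs.IsLeftDescent w j ↔ signedPerm cs w⁻¹ j < signedPerm cs w⁻¹ ((j : ℤ) - 1) := by
  rw [← cs.isRightDescent_inv_iff, isRightDescent_iff_lt]

lemma signedPerm_mem_Ico {q : ℕ} {w : W}
    (hw : w ∈ Subgroup.closure (cs.simple '' {j : Fin n | (j : ℕ) < q})) {x : ℤ}
    (hx : x ∈ Set.Ico (-(q : ℤ)) q) : signedPerm cs w x ∈ Set.Ico (-(q : ℤ)) q := by
  have step (j : Fin n) (hj : (j : ℕ) < q) {y : ℤ} (hy : y ∈ Set.Ico (-(q : ℤ)) q) :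
      simpleFlip j y ∈ Set.Ico (-(q : ℤ)) q := by
    rw [Set.mem_Ico] at hy ⊢
    unfold simpleFlip
    split_ifs <;> omega
  induction hw using Subgroup.closure_induction_left with
  | one => simpa using hx
  | mul_left s hs y hy ih =>
    obtain ⟨j, hj, rfl⟩ := hs
    rw [map_mul, signedPerm_simple]
    exact step j hj ih
  | inv_mul_cancel s hs y hy ih =>
    obtain ⟨j, hj, rfl⟩ := hs
    rw [cs.inv_simple, map_mul, signedPerm_simple]
    exact step j hj ih

lemma length_mul_of_strictMonoOn {q : ℕ} {w u : W}
    (hw : w ∈ Subgroup.closure (cs.simple '' {j : Fin n | (j : ℕ) < q}))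
    (hu : StrictMonoOn (signedPerm cs u⁻¹) (Set.Ico (-(q : ℤ)) q)) :
    cs.length (w * u) = cs.length w + cs.length u := by
  have step (j : Fin n) (hj : (j : ℕ) < q) (y : W)
      (hy : y ∈ Subgroup.closure (cs.simple '' {j : Fin n | (j : ℕ) < q}))
      (ih : cs.length (y * u) = cs.length y + cs.length u) :
      cs.length (cs.simple j * y * u) = cs.length (cs.simple j * y) + cs.length u := by
    have hiff : cs.IsLeftDescent (y * u) j ↔ cs.IsLeftDescent y j := by
      rw [isLeftDescent_iff_lt, isLeftDescent_iff_lt, mul_inv_rev, map_mul, Equiv.Perm.mul_apply,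
        Equiv.Perm.mul_apply]
      refine hu.lt_iff_lt ?_ ?_ <;> refine signedPerm_mem_Ico cs (inv_mem hy) ?_ <;>
        rw [Set.mem_Ico] <;> omega
    rw [mul_assoc]
    by_cases h : cs.IsLeftDescent y j
    · have h₁ := cs.isLeftDescent_iff.1 h
      have h₂ := cs.isLeftDescent_iff.1 (hiff.2 h)
      omega
    · have h₁ := cs.not_isLeftDescent_iff.1 h
      have h₂ := cs.not_isLeftDescent_iff.1 (mt hiff.1 h)
      omega
  induction hw using Subgroup.closure_induction_left with
  | one => simp
  | mul_left s hs y hy ih =>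
    obtain ⟨j, hj, rfl⟩ := hs
    exact step j hj y hy ih
  | inv_mul_cancel s hs y hy ih =>
    obtain ⟨j, hj, rfl⟩ := hs
    rw [cs.inv_simple]
    exact step j hj y hy ih

lemma signedPerm_tau_apply {k : ℕ} (hk : k ≤ n) (x : ℤ) :
    signedPerm cs (tau cs k) x =
      if 0 ≤ x ∧ x < (k : ℤ) - 1 then x + 1 else if x = (k : ℤ) - 1 then -1
        else if -(k : ℤ) < x ∧ x < 0 then x - 1 else if x = -(k : ℤ) then 0 else x := by
  induction k generalizing x with
  | zero =>
    simp only [tau, List.range_zero, List.map_nil, List.prod_nil, map_one, Equiv.Perm.one_apply]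
    split_ifs <;> omega
  | succ k ih =>
    rw [tau, List.range_succ, List.map_append, List.prod_append, map_mul, Equiv.Perm.mul_apply,
      List.map_singleton, List.prod_singleton, signedPerm_sgen cs hk, simpleFlipPerm_apply]
    change signedPerm cs (tau cs k) _ = _
    rw [ih (by omega)]
    by_cases h₁ : x = (k : ℤ) - 1
    · rw [simpleFlip_of_eq_sub_one h₁]
      push_cast
      split_ifs <;> omega
    by_cases h₂ : x = k
    · rw [simpleFlip_of_eq h₂]
      push_cast
      split_ifs <;> omega
    by_cases h₃ : x = -(k : ℤ)
    · rw [simpleFlip_of_eq_neg h₃]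
      push_cast
      split_ifs <;> omega
    by_cases h₄ : x = -1 - (k : ℤ)
    · rw [simpleFlip_of_eq_neg_one_sub h₄]
      push_cast
      split_ifs <;> omega
    rw [simpleFlip_of_ne h₁ h₂ h₃ h₄]
    push_cast
    split_ifs <;> omega

/-- The element at position `p` of the cycle `0, 1, …, k-1, -1, -2, …, -k` of `τ_k`. -/
def cycleElem (k : ℕ) (p : ℤ) : ℤ := if p < k then p else k - 1 - p

lemma signedPerm_tau_pow_cycleElem {k : ℕ} (hk : k ≤ n) (e : ℕ) {p : ℤ} (hp : 0 ≤ p)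
    (hpe : p + e < 2 * k) :
    signedPerm cs (tau cs k ^ e) (cycleElem k p) = cycleElem k (p + e) := by
  induction e with
  | zero => simp
  | succ e ih =>
    rw [pow_succ', map_mul, Equiv.Perm.mul_apply, ih (by omega), signedPerm_tau_apply cs hk]
    unfold cycleElem
    split_ifs <;> omega

lemma signedPerm_tau_zpow_cycleElem {k : ℕ} (hk : k ≤ n) (e : ℤ) {p : ℤ} (hp : 0 ≤ p)
    (hp' : p < 2 * k) (hpe : 0 ≤ p + e) (hpe' : p + e < 2 * k) :
    signedPerm cs (tau cs k ^ e) (cycleElem k p) = cycleElem k (p + e) := by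
  obtain ⟨e, rfl | rfl⟩ := e.eq_nat_or_neg
  · rw [zpow_natCast, signedPerm_tau_pow_cycleElem cs hk e hp hpe']
  · rw [zpow_neg, zpow_natCast, map_inv, Equiv.Perm.inv_eq_iff_eq,
      signedPerm_tau_pow_cycleElem cs hk e hpe (by omega), neg_add_cancel_right]

/-- Both `x` and `y` lie, in this order, in the window of length `k` starting at position `P` of
the cycle of `τ_k`. -/
def InWindow (k : ℕ) (P x y : ℤ) : Prop :=
  ∃ p p', P ≤ p ∧ p ≤ p' ∧ p' < P + k ∧ x = cycleElem k p ∧ y = cycleElem k p'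

lemma InWindow.tau_zpow {k k' : ℕ} {P P' x y : ℤ} (h : InWindow k P x y) (hkk' : k ≤ k')
    (hk' : k' ≤ n) (hP : 0 ≤ P) (hPk : P ≤ k) (hP' : 0 ≤ P') (hPk' : P' ≤ k') :
    InWindow k' P' (signedPerm cs (tau cs k' ^ (P' - P)) x)
      (signedPerm cs (tau cs k' ^ (P' - P)) y) := by
  have shift (p : ℤ) : cycleElem k p = cycleElem k' (if p < k then p else p + k' - k) := by
    unfold cycleElem
    split_ifs <;> omega
  obtain ⟨p, p', hp, hpp', hp', rfl, rfl⟩ := h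
  rw [shift p, shift p']
  refine ⟨_, _, ?_, ?_, ?_, signedPerm_tau_zpow_cycleElem cs hk' (P' - P) ?_ ?_ ?_ ?_,
    signedPerm_tau_zpow_cycleElem cs hk' (P' - P) ?_ ?_ ?_ ?_⟩ <;> split_ifs <;> omega

end CoxeterB

namespace IsAdmissible

open CoxeterB

variable {cs : CoxeterSystem (BCoxeterMatrix n) W} {u : W} {m : ℕ} {k : Fin m → ℕ} {i : Fin m → ℤ}

lemma inWindow (h : IsAdmissible cs u m k i) (hm : 0 < m) {x y : ℤ} (hx : 0 ≤ x) (hxy : x ≤ y)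
    (hy : y < k ⟨0, hm⟩) :
    InWindow (k ⟨m - 1, by omega⟩) 0 (signedPerm cs u⁻¹ x) (signedPerm cs u⁻¹ y) := by
  set f : ℕ → W := fun j ↦ if hj : j < m then tau cs (k ⟨j, hj⟩) ^ i ⟨j, hj⟩ else 1 with hf
  set P : ℕ → ℤ := fun r ↦ ∑ j ∈ Finset.univ.filter (fun j : Fin m ↦ r ≤ (j : ℕ)), i j with hP
  have hP0 : P 0 = 0 := by simpa [hP] using h.total
  have hPm : P m = 0 := Finset.sum_eq_zero fun j hj ↦ by
    have := (Finset.mem_filter.1 hj).2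
    omega
  have hPsucc (r : ℕ) (hr : r < m) : P r = i ⟨r, hr⟩ + P (r + 1) := by
    have : Finset.univ.filter (fun j : Fin m ↦ r ≤ (j : ℕ)) =
        insert ⟨r, hr⟩ (Finset.univ.filter fun j : Fin m ↦ r + 1 ≤ (j : ℕ)) := by
      ext j
      simp only [Finset.mem_filter, Finset.mem_univ, true_and, Finset.mem_insert, Fin.ext_iff]
      omega
    simp only [hP, this]
    exact Finset.sum_insert (by simp)
  have hbound (r : ℕ) (hr : r ≤ m) : 0 ≤ P r ∧ P r ≤ k ⟨r - 1, by omega⟩ := by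
    rcases Nat.eq_zero_or_pos r with rfl | hr0
    · simp [hP0]
    rcases hr.eq_or_lt with rfl | hr
    · simp [hPm]
    exact h.partialSum r hr0 hr
  have hprod : u = ((List.range m).map f).prod := by
    rw [h.prod_eq, ← List.map_coe_finRange_eq_range, List.map_map]
    simp [hf, Function.comp_def]
  have main (r : ℕ) (hr : r ≤ m) : InWindow (k ⟨r - 1, by omega⟩) (P r)
      (signedPerm cs (((List.range r).map f).prod)⁻¹ x)
      (signedPerm cs (((List.range r).map f).prod)⁻¹ y) := by
    induction r with
    | zero =>
      refine ⟨x, y, by omega, hxy, ?_, ?_, ?_⟩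
      · simpa [hP0] using hy
      · simp only [List.range_zero, List.map_nil, List.prod_nil, inv_one, map_one,
          Equiv.Perm.one_apply, cycleElem]
        exact (if_pos (by simpa using hxy.trans_lt hy)).symm
      · simp only [List.range_zero, List.map_nil, List.prod_nil, inv_one, map_one,
          Equiv.Perm.one_apply, cycleElem]
        exact (if_pos (by simpa using hy)).symm
    | succ r ih =>
      have hfr : (f r)⁻¹ = tau cs (k ⟨r, hr⟩) ^ (P (r + 1) - P r) := by
        rw [hPsucc r hr, sub_add_cancel_right, zpow_neg]
        simp only [hf, dif_pos (show r < m from hr)]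
      rw [List.range_succ, List.map_append, List.prod_append, List.map_singleton,
        List.prod_singleton, mul_inv_rev, map_mul, Equiv.Perm.mul_apply, Equiv.Perm.mul_apply, hfr]
      exact (ih (by omega)).tau_zpow cs (h.mono.monotone (Fin.mk_le_mk.2 (Nat.sub_le r 1)))
        (h.le_n _) (hbound r (by omega)).1 (hbound r (by omega)).2 (hbound (r + 1) hr).1
        (hbound (r + 1) hr).2
  rw [hprod, ← hPm]
  exact main m le_rfl

/-- The inverse of an element with an admissible presentation is increasing, as a signed
permutation, on the first `k_1` positions. -/
lemma strictMonoOn_signedPerm_inv (h : IsAdmissible cs u m k i) (hm : 0 < m) :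
    StrictMonoOn (signedPerm cs u⁻¹) (Set.Ico (-(k ⟨0, hm⟩ : ℤ)) (k ⟨0, hm⟩)) := by
  have key {x y : ℤ} (hx : 0 ≤ x) (hxy : x ≤ y) (hy : y < k ⟨0, hm⟩) :
      0 ≤ signedPerm cs u⁻¹ x ∧ signedPerm cs u⁻¹ x ≤ signedPerm cs u⁻¹ y := by
    obtain ⟨p, p', hp, hpp', hp', hx', hy'⟩ := h.inWindow hm hx hxy hy
    rw [cycleElem, if_pos (by omega)] at hx' hy'
    omega
  intro x hx y hy hxy
  rw [Set.mem_Ico] at hx hy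
  refine lt_of_le_of_ne ?_ ((signedPerm cs u⁻¹).injective.ne hxy.ne)
  have hx₁ := signedPerm_neg_one_sub cs u⁻¹ x
  have hy₁ := signedPerm_neg_one_sub cs u⁻¹ y
  rcases lt_or_ge x 0 with hx0 | hx0
  · rcases lt_or_ge y 0 with hy0 | hy0
    · have := (key (x := -1 - y) (y := -1 - x) (by omega) (by omega) (by omega)).2
      omega
    · have h₁ := (key (x := -1 - x) (y := -1 - x) (by omega) le_rfl (by omega)).1
      have h₂ := (key hy0 le_rfl hy.2).1
      omega
  · exact (key hx0 hxy.le hy.2).2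

end IsAdmissible

/-- If `w` lies in the parabolic subgroup generated by `s_0, …, s_{q-1}` and `u`
has an `Ṡ_n`-admissible presentation with `k_1 ≥ q`, then `ℓ(w·u) = ℓ(w) + ℓ(u)`. -/
theorem length_mul_of_admissible (cs : CoxeterSystem (BCoxeterMatrix n) W)
    (q : ℕ) (hq1 : 1 ≤ q) (hqn : q ≤ n) (w : W)
    (hw : w ∈ Subgroup.closure (cs.simple '' {j : Fin n | (j : ℕ) < q}))
    (u : W) (m : ℕ) (k : Fin m → ℕ) (i : Fin m → ℤ)
    (h : IsAdmissible cs u m k i) (hm : 0 < m) (hk1 : q ≤ k ⟨0, hm⟩) :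
    cs.length (w * u) = cs.length w + cs.length u := by
  have hsub : Set.Ico (-(q : ℤ)) q ⊆ Set.Ico (-(k ⟨0, hm⟩ : ℤ)) (k ⟨0, hm⟩) :=
    Set.Ico_subset_Ico (by omega) (by omega)
  exact CoxeterB.length_mul_of_strictMonoOn cs hw ((h.strictMonoOn_signedPerm_inv hm).mono hsub)
end
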